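/- arXiv:1004.2098 — 2 statements merged into one kernel-verified Lean document; each statement's English description precedes it below -/
import Mathlib

section
/- (Fractional Duhamel principle, Caputo derivative, distributed order.) Let X be a Banach space, m a positive integer, m−1 < μ < m, λ a finite Borel measure on [0, m−1], and B : [0, m−1] → L(X) a family of continuous linear operators on X that is strongly continuous in α with sup_α ‖B(α)‖ < ∞. For an m-times differentiable X-valued function u on [τ,∞), define _τL^{(μ,λ)}[u](t) = _τD_*^μ u(t) + ∫_0^{m−1} B(α) (_τD_*^α u(t)) dλ(α). Let h : [0,∞) → X be continuously differentiable, and assume D_+^{m−μ} h is continuous on (0,∞) and locally Bochner-integrable on [0,∞). Suppose V(t,τ), defined for 0 ≤ τ ≤ t, is m times continuously differentiable in t with all partial derivatives ∂^j V/∂t^j, 0 ≤ j ≤ m, jointly continuous for t > τ, and for every τ ≥ 0: (i) _τL^{(μ,λ)}[V(·,τ)](t) = 0 for all t > τ; (ii) (∂^k V/∂t^k)(t,τ)|_{t=τ+} = 0 for k = 0, …, m−2; (iii) (∂^{m−1} V/∂t^{m−1})(t,τ)|_{t=τ+} = D_+^{m−μ} h(τ). Then the Duhamel integral u(t) = ∫_0^t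 V(t,τ) dτ satisfies L^{(μ,λ)}[u](t) = h(t) for all t > 0 (with terminal point τ = 0 in the operator), together with the homogeneous Cauchy conditions u^{(k)}(0) = 0 for k = 0, …, m−1. -/
open MeasureTheory Filter Topology intervalIntegral

/-- Riemann–Liouville fractional integral of order `β` with terminal point `τ`:
`_τJ^β g(t) = (1/Γ(β)) ∫_τ^t (t-s)^(β-1) g(s) ds`. -/
noncomputable def fracInt {X : Type*} [NormedAddCommGroup X] [NormedSpace ℝ X]
    (β τ : ℝ) (g : ℝ → X) (t : ℝ) : X :=
  (Real.Gamma β)⁻¹ • ∫ s in τ..t, ((t - s) ^ (β - 1)) • g s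

/-- Riemann–Liouville fractional derivative of order `α ∈ (0,1)` with terminal point `τ`:
`_τD_+^α g(t) = (d/dt) _τJ^{1-α} g(t)`. -/
noncomputable def rlDeriv {X : Type*} [NormedAddCommGroup X] [NormedSpace ℝ X]
    (α τ : ℝ) (g : ℝ → X) (t : ℝ) : X :=
  deriv (fun r => fracInt (1 - α) τ g r) t

/-- Caputo–Djrbashian fractional derivative of order `α ≥ 0` with terminal point `τ`:
for noninteger `α` with `k-1 < α < k`, `_τD_*^α g(t) = (1/Γ(k-α)) ∫_τ^t (t-s)^(k-α-1) g^{(k)}(s) ds`;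
for integer `α = n`, `_τD_*^n g = g^{(n)}`. -/
noncomputable def caputoD {X : Type*} [NormedAddCommGroup X] [NormedSpace ℝ X]
    (α τ : ℝ) (g : ℝ → X) (t : ℝ) : X :=
  if α = (⌈α⌉₊ : ℝ) then iteratedDeriv ⌈α⌉₊ g t
  else (Real.Gamma ((⌈α⌉₊ : ℝ) - α))⁻¹ •
    ∫ s in τ..t, ((t - s) ^ (((⌈α⌉₊ : ℝ) - α) - 1)) • iteratedDeriv ⌈α⌉₊ g s

section

open scoped ENNReal

/-- The kernel `r₊^(a-1) / Γ(a)` of the Riemann–Liouville fractional integral. -/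
noncomputable def rlKernel (a r : ℝ) : ℝ :=
  if 0 < r then (Real.Gamma a)⁻¹ * r ^ (a - 1) else 0

lemma rlKernel_of_pos {a r : ℝ} (hr : 0 < r) :
    rlKernel a r = (Real.Gamma a)⁻¹ * r ^ (a - 1) := if_pos hr

lemma rlKernel_of_nonpos {a r : ℝ} (hr : r ≤ 0) : rlKernel a r = 0 := if_neg hr.not_gt

lemma rlKernel_nonneg {a : ℝ} (ha : 0 < a) (r : ℝ) : 0 ≤ rlKernel a r := by
  unfold rlKernel
  split_ifs with hr
  · exact mul_nonneg (inv_nonneg.2 (Real.Gamma_pos_of_pos ha).le) (Real.rpow_nonneg hr.le _)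
  · exact le_rfl

lemma rlKernel_one_of_pos {r : ℝ} (hr : 0 < r) : rlKernel 1 r = 1 := by
  simp [rlKernel_of_pos hr]

lemma enorm_rlKernel {a : ℝ} (ha : 0 < a) (r : ℝ) :
    ‖rlKernel a r‖ₑ = ENNReal.ofReal (rlKernel a r) :=
  Real.enorm_of_nonneg (rlKernel_nonneg ha r)

lemma continuous_inv_Gamma : Continuous fun a : ℝ => (Real.Gamma a)⁻¹ := by
  have h := Complex.continuous_re.comp
    (Complex.differentiable_one_div_Gamma.continuous.comp Complex.continuous_ofReal)
  refine h.congr fun a => ?_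
  simp only [Function.comp_apply, Complex.Gamma_ofReal, ← Complex.ofReal_inv, Complex.ofReal_re]

@[fun_prop]
lemma measurable_rlKernel : Measurable fun p : ℝ × ℝ => rlKernel p.1 p.2 := by
  unfold rlKernel
  refine Measurable.ite (measurableSet_lt measurable_const measurable_snd) ?_ measurable_const
  exact (continuous_inv_Gamma.measurable.comp measurable_fst).mul
    (measurable_snd.pow (measurable_fst.sub_const 1))

@[fun_prop]
lemma Measurable.rlKernel {δ : Type*} [MeasurableSpace δ] {f g : δ → ℝ} (hf : Measurable f)
    (hg : Measurable g) : Measurable fun x => rlKernel (f x) (g x) :=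
  measurable_rlKernel.comp (hf.prodMk hg)

lemma lintegral_rlKernel_mul {a b : ℝ} (ha : 0 < a) (hb : 0 < b) (t r : ℝ) :
    ∫⁻ s, ‖rlKernel a (t - s)‖ₑ * ‖rlKernel b (s - r)‖ₑ = ‖rlKernel (a + b) (t - r)‖ₑ := by
  rcases le_or_gt t r with h | h
  · rw [rlKernel_of_nonpos (sub_nonpos.2 h), enorm_zero]
    refine lintegral_eq_zero_of_ae_eq_zero (Eventually.of_forall fun s => ?_)
    rcases le_or_gt t s with h1 | h1
    · simp [rlKernel_of_nonpos (sub_nonpos.2 h1)]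
    · simp [rlKernel_of_nonpos (sub_nonpos.2 (h1.le.trans h))]
  · set d := t - r with hd
    have hd0 : 0 < d := sub_pos.2 h
    have key : ∀ x : ℝ, ‖rlKernel a (d - d * x)‖ₑ * ‖rlKernel b (d * x)‖ₑ
        = ENNReal.ofReal ((Real.Gamma (a + b))⁻¹ * d ^ (a + b - 2))
          * ProbabilityTheory.betaPDF b a x := by
      intro x
      rw [enorm_rlKernel ha, enorm_rlKernel hb, ProbabilityTheory.betaPDF_eq]
      by_cases hx : 0 < x ∧ x < 1
      · have h1 : 0 < 1 - x := by linarith [hx.2]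
        have e1 : d - d * x = d * (1 - x) := by ring
        rw [if_pos hx, e1, rlKernel_of_pos (mul_pos hd0 h1), rlKernel_of_pos (mul_pos hd0 hx.1),
          ← ENNReal.ofReal_mul, ← ENNReal.ofReal_mul]
        · congr 1
          rw [Real.mul_rpow hd0.le h1.le, Real.mul_rpow hd0.le hx.1.le, ProbabilityTheory.beta,
            show a + b - 2 = (a - 1) + (b - 1) by ring, Real.rpow_add hd0, add_comm b a]
          have := (Real.Gamma_pos_of_pos ha).ne'
          have := (Real.Gamma_pos_of_pos hb).ne'
          have := (Real.Gamma_pos_of_pos (add_pos ha hb)).ne'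
          field_simp
        · exact mul_nonneg (inv_nonneg.2 (Real.Gamma_pos_of_pos (add_pos ha hb)).le)
            (Real.rpow_nonneg hd0.le _)
        · exact mul_nonneg (inv_nonneg.2 (Real.Gamma_pos_of_pos ha).le)
            (Real.rpow_nonneg (mul_pos hd0 h1).le _)
      · rw [if_neg hx]
        rcases le_or_gt x 0 with h1 | h1
        · simp [rlKernel_of_nonpos (mul_nonpos_of_nonneg_of_nonpos hd0.le h1)]
        · have h2 : 1 ≤ x := by
            by_contra! h3
            exact hx ⟨h1, h3⟩
          simp [rlKernel_of_nonpos (show d - d * x ≤ 0 by nlinarith)]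
    have e1 : ∫⁻ s, ‖rlKernel a (t - s)‖ₑ * ‖rlKernel b (s - r)‖ₑ
        = ∫⁻ s, ‖rlKernel a (d - s)‖ₑ * ‖rlKernel b s‖ₑ := by
      rw [← lintegral_sub_right_eq_self (μ := volume)
        (fun s => ‖rlKernel a (d - s)‖ₑ * ‖rlKernel b s‖ₑ) r]
      refine lintegral_congr fun s => ?_
      rw [hd]; congr 3; ring
    have hm : Measurable fun s => ‖rlKernel a (d - s)‖ₑ * ‖rlKernel b s‖ₑ := by fun_prop
    have e2 := Real.smul_map_volume_mul_left hd0.ne'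
    rw [e1, ← e2, lintegral_smul_measure, lintegral_map hm (measurable_const_mul d)]
    simp_rw [key]
    rw [lintegral_const_mul' _ _ ENNReal.ofReal_ne_top,
      ProbabilityTheory.lintegral_betaPDF_eq_one hb ha, mul_one, smul_eq_mul,
      ← ENNReal.ofReal_mul (abs_nonneg d), enorm_rlKernel (add_pos ha hb), rlKernel_of_pos hd0]
    congr 1
    rw [abs_of_pos hd0, show a + b - 1 = 1 + (a + b - 2) by ring, Real.rpow_add hd0, Real.rpow_one]
    ring

lemma integrable_rlKernel_mul {a b : ℝ} (ha : 0 < a) (hb : 0 < b) (t r : ℝ) :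
    Integrable fun s => rlKernel a (t - s) * rlKernel b (s - r) := by
  refine ⟨Measurable.aestronglyMeasurable (by fun_prop), ?_⟩
  simp_rw [HasFiniteIntegral, enorm_mul]
  rw [lintegral_rlKernel_mul ha hb]
  exact enorm_lt_top

lemma integral_rlKernel_mul {a b : ℝ} (ha : 0 < a) (hb : 0 < b) (t r : ℝ) :
    ∫ s, rlKernel a (t - s) * rlKernel b (s - r) = rlKernel (a + b) (t - r) := by
  have h := lintegral_rlKernel_mul ha hb t r
  rw [integral_eq_lintegral_of_nonneg_ae (Eventually.of_forall fun s =>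
    mul_nonneg (rlKernel_nonneg ha _) (rlKernel_nonneg hb _))
    (Measurable.aestronglyMeasurable (by fun_prop))]
  simp_rw [ENNReal.ofReal_mul (rlKernel_nonneg ha _), ← enorm_rlKernel ha, ← enorm_rlKernel hb]
  rw [h, enorm_rlKernel (add_pos ha hb), ENNReal.toReal_ofReal (rlKernel_nonneg (add_pos ha hb) _)]

lemma exists_rlKernel_le (a₀ a₁ T : ℝ) (ha : 0 < a₀) :
    ∃ C : ℝ, 0 ≤ C ∧ ∀ a ∈ Set.Icc a₀ a₁, ∀ r ≤ T, rlKernel a r ≤ C * rlKernel a₀ r := by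
  obtain ⟨M, hM⟩ := (isCompact_Icc (a := a₀) (b := a₁)).exists_bound_of_continuousOn
    continuous_inv_Gamma.continuousOn
  set R := max 1 T
  have hR : 1 ≤ R := le_max_left _ _
  have hG := Real.Gamma_pos_of_pos ha
  refine ⟨|M| * R ^ (a₁ - a₀) * Real.Gamma a₀, by positivity, fun a haa r hr => ?_⟩
  rcases le_or_gt r 0 with h | h
  · simp [rlKernel_of_nonpos h]
  rw [rlKernel_of_pos h, rlKernel_of_pos h]
  have h1 : (Real.Gamma a)⁻¹ ≤ |M| := (le_abs_self _).trans ((hM a haa).trans (le_abs_self _))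
  have h2 : r ^ (a - 1) ≤ R ^ (a₁ - a₀) * r ^ (a₀ - 1) := by
    rw [show a - 1 = (a - a₀) + (a₀ - 1) by ring, Real.rpow_add h]
    refine mul_le_mul_of_nonneg_right ?_ (Real.rpow_nonneg h.le _)
    calc r ^ (a - a₀) ≤ R ^ (a - a₀) :=
          Real.rpow_le_rpow h.le (hr.trans (le_max_right _ _)) (sub_nonneg.2 haa.1)
      _ ≤ R ^ (a₁ - a₀) := Real.rpow_le_rpow_of_exponent_le hR (by linarith [haa.2])
  calc (Real.Gamma a)⁻¹ * r ^ (a - 1) ≤ |M| * (R ^ (a₁ - a₀) * r ^ (a₀ - 1)) :=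
        mul_le_mul h1 h2 (Real.rpow_nonneg h.le _) (abs_nonneg _)
    _ = _ := by field_simp

lemma exists_enorm_rlKernel_le (a₀ a₁ T : ℝ) (ha : 0 < a₀) :
    ∃ C : ℝ≥0∞, C ≠ ∞ ∧
      ∀ a ∈ Set.Icc a₀ a₁, ∀ r ≤ T, ‖rlKernel a r‖ₑ ≤ C * ‖rlKernel a₀ r‖ₑ := by
  obtain ⟨C, hC, h⟩ := exists_rlKernel_le a₀ a₁ T ha
  refine ⟨ENNReal.ofReal C, ENNReal.ofReal_ne_top, fun a haa r hr => ?_⟩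
  rw [enorm_rlKernel ha, enorm_rlKernel (ha.trans_le haa.1), ← ENNReal.ofReal_mul hC]
  exact ENNReal.ofReal_le_ofReal (h a haa r hr)

lemma lintegral_rlKernel_mul_exp {b σ : ℝ} (hb : 0 < b) (hσ : 0 < σ) :
    ∫⁻ r, ‖rlKernel b r‖ₑ * ENNReal.ofReal (Real.exp (-(σ * r))) = ENNReal.ofReal (σ ^ (-b)) := by
  have key : ∀ r : ℝ, r ≠ 0 → ‖rlKernel b r‖ₑ * ENNReal.ofReal (Real.exp (-(σ * r)))
      = ENNReal.ofReal (σ ^ (-b)) * ProbabilityTheory.gammaPDF b σ r := by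
    intro r hr0
    rw [enorm_rlKernel hb]
    rcases le_or_gt r 0 with h | h
    · rw [ProbabilityTheory.gammaPDF_of_neg (lt_of_le_of_ne h hr0), rlKernel_of_nonpos h]; simp
    · rw [ProbabilityTheory.gammaPDF_of_nonneg h.le, rlKernel_of_pos h,
        ← ENNReal.ofReal_mul (Real.rpow_nonneg hσ.le _), ← ENNReal.ofReal_mul]
      · congr 1
        rw [Real.rpow_neg hσ.le]
        have := (Real.Gamma_pos_of_pos hb).ne'
        have := (Real.rpow_pos_of_pos hσ b).ne'
        field_simp
      · exact mul_nonneg (inv_nonneg.2 (Real.Gamma_pos_of_pos hb).le) (Real.rpow_nonneg h.le _)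
  have hae : ∀ᵐ r : ℝ, r ≠ 0 := by simp [ae_iff]
  rw [lintegral_congr_ae (hae.mono key), lintegral_const_mul' _ _ ENNReal.ofReal_ne_top,
    ProbabilityTheory.lintegral_gammaPDF_eq_one hb hσ, mul_one]

section

lemma lintegral_rlKernel_assoc {a b : ℝ} (ha : 0 < a) (hb : 0 < b) {f : ℝ → ℝ≥0∞}
    (hf : AEMeasurable f) (t : ℝ) :
    ∫⁻ s, ‖rlKernel a (t - s)‖ₑ * ∫⁻ r, ‖rlKernel b (s - r)‖ₑ * f r
      = ∫⁻ r, ‖rlKernel (a + b) (t - r)‖ₑ * f r := by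
  have h1 : ∀ s, ‖rlKernel a (t - s)‖ₑ * ∫⁻ r, ‖rlKernel b (s - r)‖ₑ * f r
      = ∫⁻ r, ‖rlKernel a (t - s)‖ₑ * ‖rlKernel b (s - r)‖ₑ * f r := by
    intro s
    rw [← lintegral_const_mul' _ _ enorm_ne_top]
    simp_rw [mul_assoc]
  simp_rw [h1]
  rw [lintegral_lintegral_swap]
  · refine lintegral_congr fun r => ?_
    rw [lintegral_mul_const _ (by fun_prop), lintegral_rlKernel_mul ha hb]
  · exact AEMeasurable.mul (Measurable.aemeasurable (by fun_prop)) hf.comp_snd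

lemma exists_lintegral_le_of_le_rlKernel {b : ℝ} (hb : 0 < b) {C : ℝ≥0∞} (hC : C ≠ ∞) (T : ℝ) :
    ∃ C' : ℝ≥0∞, C' ≠ ∞ ∧ ∀ τ, 0 ≤ τ → ∀ (x : ℝ≥0∞) (f : ℝ → ℝ≥0∞), Measurable f →
      ∫⁻ s in Set.Iio T, f s ≠ ∞ → (∀ s ≤ τ, f s = 0) →
      (∀ᵐ s, s < T → f s ≤
        C * (‖rlKernel b (s - τ)‖ₑ * x + ∫⁻ r, ‖rlKernel b (s - r)‖ₑ * f r)) →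
      ∫⁻ s in Set.Iio T, f s ≤ C' * x := by
  obtain ⟨σ, hσ, hσC⟩ : ∃ σ : ℝ, 0 < σ ∧ C * ENNReal.ofReal (σ ^ (-b)) ≤ 2⁻¹ := by
    have h1 : Tendsto (fun σ : ℝ => C * ENNReal.ofReal (σ ^ (-b))) atTop
        (𝓝 (C * ENNReal.ofReal 0)) :=
      ENNReal.Tendsto.const_mul (ENNReal.tendsto_ofReal (tendsto_rpow_neg_atTop hb)) (Or.inr hC)
    rw [ENNReal.ofReal_zero, mul_zero] at h1
    have h2 := h1.eventually (ge_mem_nhds (show (0 : ℝ≥0∞) < 2⁻¹ by simp))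
    obtain ⟨σ, h3, h4⟩ := (h2.and (eventually_gt_atTop 0)).exists
    exact ⟨σ, h4, h3⟩
  refine ⟨ENNReal.ofReal (Real.exp (σ * T)), ENNReal.ofReal_ne_top, ?_⟩
  intro τ hτ x f hf hfin hsupp hle
  set e : ℝ → ℝ≥0∞ := fun r => ENNReal.ofReal (Real.exp (-(σ * r))) with he
  have hem : Measurable e := by fun_prop
  have e_add : ∀ r s, e (r + s) = e r * e s := fun r s => by
    simp only [he]
    rw [← ENNReal.ofReal_mul (Real.exp_pos _).le, ← Real.exp_add]
    congr 2; ring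
  set g : ℝ → ℝ≥0∞ := (Set.Iio T).indicator f with hg
  have hgm : Measurable g := hf.indicator measurableSet_Iio
  have hgf : ∫⁻ s, g s = ∫⁻ s in Set.Iio T, f s := lintegral_indicator measurableSet_Iio f
  have hgle : ∀ᵐ s, g s ≤
      C * (‖rlKernel b (s - τ)‖ₑ * x + ∫⁻ r, ‖rlKernel b (s - r)‖ₑ * g r) := by
    filter_upwards [hle] with s hs
    by_cases hsT : s < T
    · have h1 : ∫⁻ r, ‖rlKernel b (s - r)‖ₑ * g r = ∫⁻ r, ‖rlKernel b (s - r)‖ₑ * f r := by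
        refine lintegral_congr fun r => ?_
        rcases le_or_gt s r with h | h
        · simp [rlKernel_of_nonpos (sub_nonpos.2 h)]
        · rw [hg, Set.indicator_of_mem (show r ∈ Set.Iio T from h.trans hsT)]
      rw [h1, hg, Set.indicator_of_mem (show s ∈ Set.Iio T from hsT)]
      exact hs hsT
    · rw [hg, Set.indicator_of_notMem (show s ∉ Set.Iio T from hsT)]
      exact zero_le
  set M := ∫⁻ s, e (s - τ) * g s with hM
  have hMfin : M ≠ ∞ := by
    refine ne_top_of_le_ne_top (hgf ▸ hfin) (lintegral_mono fun s => ?_)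
    rcases le_or_gt s τ with h | h
    · have : g s = 0 := by
        simp only [hg, Set.indicator_apply_eq_zero]
        exact fun _ => hsupp s h
      simp [this]
    · refine mul_le_of_le_one_left' ?_
      simp only [he]
      rw [ENNReal.ofReal_le_one, Real.exp_le_one_iff]
      nlinarith
  set S := ENNReal.ofReal (σ ^ (-b)) with hS
  have hS' : ∀ r, ∫⁻ s, e (s - r) * ‖rlKernel b (s - r)‖ₑ = S := by
    intro r
    rw [lintegral_sub_right_eq_self (μ := volume) (fun s => e s * ‖rlKernel b s‖ₑ) r,
      hS, ← lintegral_rlKernel_mul_exp hb hσ]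
    exact lintegral_congr fun s => mul_comm _ _
  have hMle : M ≤ C * (S * x + S * M) := by
    calc M ≤ ∫⁻ s, C * (e (s - τ) * ‖rlKernel b (s - τ)‖ₑ * x
          + ∫⁻ r, e (s - τ) * ‖rlKernel b (s - r)‖ₑ * g r) := by
          refine lintegral_mono_ae ?_
          filter_upwards [hgle] with s hs
          refine (mul_le_mul_right hs (e (s - τ))).trans (le_of_eq ?_)
          simp_rw [mul_assoc]
          rw [lintegral_const_mul' _ _ ENNReal.ofReal_ne_top]
          ring
      _ = C * (S * x + S * M) := by
          rw [lintegral_const_mul' _ _ hC, lintegral_add_left' (by fun_prop),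
            lintegral_mul_const _ (by fun_prop), hS', lintegral_lintegral_swap]
          · congr 2
            rw [hM, ← lintegral_const_mul _ (by fun_prop)]
            refine lintegral_congr fun r => ?_
            rw [lintegral_mul_const _ (by fun_prop), ← mul_assoc]
            congr 1
            rw [← hS' r, ← lintegral_mul_const _ (by fun_prop)]
            refine lintegral_congr fun s => ?_
            rw [show s - τ = (s - r) + (r - τ) by ring, e_add]
            ring
          · exact Measurable.aemeasurable (by unfold Function.uncurry; fun_prop)
  have hMx : M ≤ x := by
    have h1 : M ≤ 2⁻¹ * (x + M) := by
      refine hMle.trans ?_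
      rw [← mul_add, ← mul_assoc]
      exact mul_le_mul_left hσC _
    have h2 : 2 * M ≤ x + M := by
      calc 2 * M ≤ 2 * (2⁻¹ * (x + M)) := mul_le_mul_right h1 2
        _ = x + M := by rw [← mul_assoc, ENNReal.mul_inv_cancel (by simp) (by simp), one_mul]
    rw [two_mul] at h2
    exact (ENNReal.add_le_add_iff_right hMfin).1 h2
  rw [← hgf]
  calc ∫⁻ s, g s ≤ ∫⁻ s, ENNReal.ofReal (Real.exp (σ * T)) * (e (s - τ) * g s) := by
        refine lintegral_mono fun s => ?_
        by_cases hsT : s < T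
        · rw [← mul_assoc]
          refine le_mul_of_one_le_left' ?_
          simp only [he]
          rw [← ENNReal.ofReal_mul (Real.exp_pos _).le, ← Real.exp_add, ENNReal.one_le_ofReal,
            Real.one_le_exp_iff]
          nlinarith
        · simp [hg, hsT]
    _ = ENNReal.ofReal (Real.exp (σ * T)) * M := lintegral_const_mul' _ _ ENNReal.ofReal_ne_top
    _ ≤ _ := mul_le_mul_right hMx _

variable {X : Type*} [NormedAddCommGroup X] [NormedSpace ℝ X]

/-- Convolution of `f : ℝ → X` with the Riemann–Liouville kernel of order `a`. -/
noncomputable def rlConv (a : ℝ) (f : ℝ → X) (t : ℝ) : X :=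
  ∫ s, rlKernel a (t - s) • f s

lemma enorm_rlConv_le (a : ℝ) (f : ℝ → X) (t : ℝ) :
    ‖rlConv a f t‖ₑ ≤ ∫⁻ s, ‖rlKernel a (t - s)‖ₑ * ‖f s‖ₑ := by
  refine (enorm_integral_le_lintegral_enorm _).trans (le_of_eq ?_)
  simp_rw [enorm_smul]

lemma aestronglyMeasurable_rlKernel_smul {f : ℝ → X} (hf : AEStronglyMeasurable f) (a t : ℝ) :
    AEStronglyMeasurable fun s => rlKernel a (t - s) • f s :=
  AEStronglyMeasurable.smul (Measurable.aestronglyMeasurable (by fun_prop)) hf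

lemma integrable_rlKernel_smul_iff {f : ℝ → X} (hf : AEStronglyMeasurable f) {a t : ℝ} :
    Integrable (fun s => rlKernel a (t - s) • f s)
      ↔ ∫⁻ s, ‖rlKernel a (t - s)‖ₑ * ‖f s‖ₑ < ∞ := by
  simp_rw [Integrable, HasFiniteIntegral, enorm_smul]
  exact and_iff_right (aestronglyMeasurable_rlKernel_smul hf a t)

lemma integrable_rlKernel_smul_rlConv_and_eq [CompleteSpace X] {a b : ℝ} (ha : 0 < a) (hb : 0 < b)
    {f : ℝ → X} (hf : AEStronglyMeasurable f) {t : ℝ}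
    (hi : Integrable fun s => rlKernel (a + b) (t - s) • f s) :
    Integrable (fun s => rlKernel a (t - s) • rlConv b f s) ∧
      rlConv a (rlConv b f) t = rlConv (a + b) f t := by
  have hprod : Integrable (Function.uncurry fun s r =>
      (rlKernel a (t - s) * rlKernel b (s - r)) • f r) (volume.prod volume) := by
    refine ⟨AEStronglyMeasurable.smul
      (Measurable.aestronglyMeasurable (by fun_prop)) hf.comp_snd, ?_⟩
    rw [HasFiniteIntegral, lintegral_prod]
    · simp only [Function.uncurry, enorm_smul, enorm_mul]
      have := (integrable_rlKernel_smul_iff hf).1 hi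
      rw [← lintegral_rlKernel_assoc ha hb hf.enorm] at this
      refine lt_of_eq_of_lt (lintegral_congr fun s => ?_) this
      rw [← lintegral_const_mul' _ _ enorm_ne_top]
      simp_rw [mul_assoc]
    · exact (AEStronglyMeasurable.smul
        (Measurable.aestronglyMeasurable (by fun_prop)) hf.comp_snd).enorm
  have e1 : ∀ s, rlKernel a (t - s) • rlConv b f s
      = ∫ r, (rlKernel a (t - s) * rlKernel b (s - r)) • f r := by
    intro s
    rw [rlConv, ← MeasureTheory.integral_smul]
    simp_rw [mul_smul]
  constructor
  · simp_rw [e1]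
    exact hprod.integral_prod_left
  · rw [rlConv]
    simp_rw [e1]
    rw [integral_integral_swap hprod]
    refine integral_congr_ae (Eventually.of_forall fun r => ?_)
    simp only
    rw [_root_.integral_smul_const, integral_rlKernel_mul ha hb]

end

section

variable {X : Type*} [NormedAddCommGroup X]

/-- Functions on the line that vanish on `(-∞, 0]` and are integrable on every `(-∞, T)`. -/
structure CausalLocInt (f : ℝ → X) : Prop where
  eq_zero : ∀ s ≤ 0, f s = 0
  integrableOn : ∀ T, IntegrableOn f (Set.Iio T)

namespace CausalLocInt

variable {f : ℝ → X}

lemma locallyIntegrable (hf : CausalLocInt f) : LocallyIntegrable f := fun x =>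
  ⟨Set.Iio (x + 1), Iio_mem_nhds (by linarith), hf.integrableOn _⟩

lemma aestronglyMeasurable (hf : CausalLocInt f) : AEStronglyMeasurable f :=
  hf.locallyIntegrable.aestronglyMeasurable

lemma add {g : ℝ → X} (hf : CausalLocInt f) (hg : CausalLocInt g) :
    CausalLocInt fun s => f s + g s where
  eq_zero s hs := by rw [hf.eq_zero s hs, hg.eq_zero s hs, add_zero]
  integrableOn T := (hf.integrableOn T).add (hg.integrableOn T)

end CausalLocInt

variable [NormedSpace ℝ X]

lemma fracInt_eq_rlConv {a τ t : ℝ} (g : ℝ → X) (h : τ ≤ t) :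
    fracInt a τ g t = rlConv a ((Set.Ioi τ).indicator g) t := by
  rw [fracInt, rlConv, intervalIntegral.integral_of_le h, integral_Ioc_eq_integral_Ioo,
    ← MeasureTheory.integral_smul, ← MeasureTheory.integral_indicator measurableSet_Ioo]
  refine integral_congr_ae (Eventually.of_forall fun s => ?_)
  simp only [Set.indicator_apply, Set.mem_Ioo, Set.mem_Ioi]
  rcases le_or_gt t s with h1 | h1
  · simp [rlKernel_of_nonpos (sub_nonpos.2 h1), h1.not_gt]
  · by_cases h2 : τ < s
    · simp [h1, h2, rlKernel_of_pos (sub_pos.2 h1), mul_smul]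
    · simp [h2]

lemma rlConv_congr_ae {f g : ℝ → X} {a t : ℝ} (h : ∀ᵐ s, s < t → f s = g s) :
    rlConv a f t = rlConv a g t := by
  refine integral_congr_ae ?_
  filter_upwards [h] with s hs
  rcases le_or_gt t s with h1 | h1
  · simp [rlKernel_of_nonpos (sub_nonpos.2 h1)]
  · rw [hs h1]

lemma rlConv_eq_zero {f : ℝ → X} {a τ t : ℝ} (hf : ∀ s ≤ τ, f s = 0) (ht : t ≤ τ) :
    rlConv a f t = 0 := by
  rw [rlConv_congr_ae (g := fun _ => 0) (Eventually.of_forall fun s hs => hf s (hs.le.trans ht))]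
  simp [rlConv]

namespace CausalLocInt

variable {f : ℝ → X}

lemma integrable_rlKernel_smul (hf : CausalLocInt f) {a : ℝ} (ha : 1 ≤ a) (t : ℝ) :
    Integrable fun s => rlKernel a (t - s) • f s := by
  obtain ⟨C, hC, h⟩ := exists_rlKernel_le 1 a t one_pos
  have h1 : Integrable ((Set.Iio t).indicator f) :=
    (integrable_indicator_iff measurableSet_Iio).2 (hf.integrableOn t)
  refine Integrable.mono' (h1.norm.const_mul C)
    (aestronglyMeasurable_rlKernel_smul hf.aestronglyMeasurable a t)
    (Eventually.of_forall fun s => ?_)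
  rcases le_or_gt s 0 with hs | hs
  · rw [hf.eq_zero s hs, smul_zero, norm_zero]; positivity
  rcases le_or_gt t s with h2 | h2
  · rw [rlKernel_of_nonpos (sub_nonpos.2 h2), zero_smul, norm_zero]; positivity
  · rw [Set.indicator_of_mem (show s ∈ Set.Iio t from h2), norm_smul,
      Real.norm_of_nonneg (rlKernel_nonneg (by linarith) _)]
    refine mul_le_mul_of_nonneg_right ?_ (norm_nonneg _)
    have := h a ⟨ha, le_rfl⟩ (t - s) (by linarith)
    rwa [rlKernel_one_of_pos (sub_pos.2 h2), mul_one] at this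

lemma _root_.rlKernel_one_smul (f : ℝ → X) (t : ℝ) :
    (fun s => rlKernel 1 (t - s) • f s) = (Set.Iio t).indicator f := by
  ext s
  rcases le_or_gt t s with h2 | h2
  · simp [rlKernel_of_nonpos (sub_nonpos.2 h2), h2]
  · simp [rlKernel_one_of_pos (sub_pos.2 h2), h2]

lemma _root_.rlConv_one (f : ℝ → X) (t : ℝ) : rlConv 1 f t = ∫ s in Set.Iio t, f s := by
  rw [rlConv, rlKernel_one_smul, MeasureTheory.integral_indicator measurableSet_Iio]

lemma rlConv_one_eq (hf : CausalLocInt f) : rlConv 1 f = fun t => ∫ s in (0:ℝ)..t, f s := by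
  ext t
  rcases le_or_gt t 0 with ht | ht
  · rw [rlConv_eq_zero hf.eq_zero ht, intervalIntegral.integral_of_ge ht,
      setIntegral_congr_fun measurableSet_Ioc (g := fun _ => 0) (fun s hs => hf.eq_zero s hs.2)]
    simp
  · rw [rlConv_one, intervalIntegral.integral_of_le ht.le, integral_Ioc_eq_integral_Ioo]
    refine setIntegral_eq_of_subset_of_forall_sdiff_eq_zero measurableSet_Iio
      (fun s hs => hs.2) (fun s hs => hf.eq_zero s ?_)
    by_contra! h
    exact hs.2 ⟨h, hs.1⟩

lemma continuous_rlConv_one (hf : CausalLocInt f) : Continuous (rlConv 1 f) := by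
  rw [hf.rlConv_one_eq]
  exact continuous_primitive (fun a b =>
    (hf.locallyIntegrable.integrableOn_isCompact isCompact_uIcc).intervalIntegrable) 0

variable [CompleteSpace X]

lemma conv (hf : CausalLocInt f) {b : ℝ} (hb : 0 < b) : CausalLocInt (rlConv b f) where
  eq_zero s hs := rlConv_eq_zero hf.eq_zero hs
  integrableOn T := by
    have := (integrable_rlKernel_smul_rlConv_and_eq one_pos hb hf.aestronglyMeasurable
      (hf.integrable_rlKernel_smul (by linarith) T)).1
    rwa [rlKernel_one_smul, integrable_indicator_iff measurableSet_Iio] at this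

lemma conv_conv (hf : CausalLocInt f) {a b : ℝ} (ha : 0 < a) (hb : 0 < b) (hab : 1 ≤ a + b) :
    rlConv a (rlConv b f) = rlConv (a + b) f :=
  funext fun t => (integrable_rlKernel_smul_rlConv_and_eq ha hb hf.aestronglyMeasurable
    (hf.integrable_rlKernel_smul hab t)).2

lemma ae_hasDerivAt_rlConv_one (hf : CausalLocInt f) :
    ∀ᵐ t, HasDerivAt (rlConv 1 f) (f t) t := by
  rw [hf.rlConv_one_eq]
  filter_upwards [_root_.LocallyIntegrable.ae_hasDerivAt_integral hf.locallyIntegrable] with t ht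
  exact ht 0

lemma continuous_rlConv (hf : CausalLocInt f) {a : ℝ} (ha : 1 ≤ a) :
    Continuous (rlConv a f) := by
  rcases ha.eq_or_lt with rfl | h
  · exact hf.continuous_rlConv_one
  · have := hf.conv_conv one_pos (sub_pos.2 h) (by linarith)
    rw [add_sub_cancel] at this
    rw [← this]
    exact (hf.conv (sub_pos.2 h)).continuous_rlConv_one

lemma hasDerivAt_rlConv (hf : CausalLocInt f) {a : ℝ} (ha : 1 ≤ a) (t : ℝ) :
    HasDerivAt (rlConv (a + 1) f) (rlConv a f t) t := by
  rw [add_comm, ← hf.conv_conv one_pos (by linarith) (by linarith),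
    (hf.conv (by linarith)).rlConv_one_eq]
  exact integral_hasDerivAt_right ((hf.continuous_rlConv ha).intervalIntegrable _ _)
    (hf.continuous_rlConv ha).stronglyMeasurable.stronglyMeasurableAtFilter
    (hf.continuous_rlConv ha).continuousAt

lemma ae_eq_zero_of_rlConv_eq_zero (hf : CausalLocInt f) {a : ℝ} (ha : 0 < a) (ha1 : a < 1)
    (h : ∀ t, rlConv a f t = 0) : ∀ᵐ t, f t = 0 := by
  have h1 : rlConv 1 f = fun _ => 0 := by
    rw [← sub_add_cancel 1 a, ← hf.conv_conv (sub_pos.2 ha1) ha (by linarith), funext h]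
    ext t
    simp [rlConv]
  filter_upwards [hf.ae_hasDerivAt_rlConv_one] with t ht
  rw [h1] at ht
  exact ht.unique (hasDerivAt_const t 0)

end CausalLocInt

lemma causalLocInt_rlKernel_smul {a τ : ℝ} (ha : 0 < a) (hτ : 0 ≤ τ) (x : X) :
    CausalLocInt fun s => rlKernel a (s - τ) • x where
  eq_zero s hs := by rw [rlKernel_of_nonpos (by linarith), zero_smul]
  integrableOn T := by
    have h := (integrable_rlKernel_mul one_pos ha T τ).smul_const x
    simp_rw [mul_smul] at h
    rwa [rlKernel_one_smul, integrable_indicator_iff measurableSet_Iio] at h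

/-- Convolution of the Riemann–Liouville kernel with the vector measure `x δ_τ + f`. -/
noncomputable def rlConvDirac (a τ : ℝ) (x : X) (f : ℝ → X) (t : ℝ) : X :=
  rlKernel a (t - τ) • x + rlConv a f t

lemma rlConv_rlKernel_smul [CompleteSpace X] {a b : ℝ} (ha : 0 < a) (hb : 0 < b) (τ : ℝ) (x : X)
    (t : ℝ) :
    rlConv a (fun s => rlKernel b (s - τ) • x) t = rlKernel (a + b) (t - τ) • x := by
  simp_rw [rlConv, ← mul_smul]
  rw [_root_.integral_smul_const, integral_rlKernel_mul ha hb]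

lemma CausalLocInt.convDirac [CompleteSpace X] {f : ℝ → X} (hf : CausalLocInt f) {a τ : ℝ}
    (ha : 0 < a) (hτ : 0 ≤ τ) (x : X) : CausalLocInt (rlConvDirac a τ x f) :=
  (causalLocInt_rlKernel_smul ha hτ x).add (hf.conv ha)

lemma integrable_rlKernel_smul_rlKernel_smul {a b : ℝ} (ha : 0 < a) (hb : 0 < b) (τ : ℝ) (x : X)
    (t : ℝ) : Integrable fun s => rlKernel a (t - s) • rlKernel b (s - τ) • x := by
  simp_rw [← mul_smul]
  exact (integrable_rlKernel_mul ha hb t τ).smul_const x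

lemma CausalLocInt.rlConv_rlConvDirac [CompleteSpace X] {f : ℝ → X} (hf : CausalLocInt f)
    {a b τ : ℝ} (ha : 0 < a) (hb : 0 < b) (hab : 1 ≤ a + b) (x : X) (t : ℝ) :
    rlConv a (rlConvDirac b τ x f) t = rlConvDirac (a + b) τ x f t := by
  have h := integrable_rlKernel_smul_rlConv_and_eq ha hb hf.aestronglyMeasurable
    (hf.integrable_rlKernel_smul hab t)
  rw [rlConvDirac, ← rlConv_rlKernel_smul ha hb, ← h.2]
  simp_rw [rlConv, rlConvDirac, smul_add]
  exact integral_add (integrable_rlKernel_smul_rlKernel_smul ha hb τ x t) h.1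

end

section

variable {X : Type*} [NormedAddCommGroup X] [NormedSpace ℝ X]

lemma aestronglyMeasurable_rlConvDirac (lam : Measure ℝ) [IsFiniteMeasure lam] (c τ : ℝ) (x : X)
    {f : ℝ → X} (hf : AEStronglyMeasurable f) :
    AEStronglyMeasurable (fun p : ℝ × ℝ => rlConvDirac (c - p.2) τ x f p.1)
      (volume.prod lam) := by
  refine AEStronglyMeasurable.add
    ((Measurable.aestronglyMeasurable (by fun_prop)).smul aestronglyMeasurable_const) ?_
  have h : AEStronglyMeasurable
      (fun q : (ℝ × ℝ) × ℝ => rlKernel (c - q.1.2) (q.1.1 - q.2) • f q.2)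
      ((volume.prod lam).prod volume) :=
    AEStronglyMeasurable.smul (Measurable.aestronglyMeasurable (by fun_prop)) hf.comp_snd
  exact h.integral_prod_right'

/-- The integrated operator `∫ B(a) (x δ_τ + f) ∗ r₊^(c-a-1)/Γ(c-a) dλ(a)`. -/
noncomputable def distConv (lam : Measure ℝ) (B : ℝ → X →L[ℝ] X) (c τ : ℝ) (x : X) (f : ℝ → X)
    (t : ℝ) : X :=
  ∫ a, B a (rlConvDirac (c - a) τ x f t) ∂lam

lemma exists_enorm_rlConvDirac_le (c d T : ℝ) (hd : d < c) :
    ∃ C : ℝ≥0∞, C ≠ ∞ ∧ ∀ a ∈ Set.Icc 0 d, ∀ τ, 0 ≤ τ → ∀ (x : X) (f : ℝ → X),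
      (∀ s ≤ 0, f s = 0) → ∀ s ≤ T, ‖rlConvDirac (c - a) τ x f s‖ₑ ≤
        C * (‖rlKernel (c - d) (s - τ)‖ₑ * ‖x‖ₑ + ∫⁻ r, ‖rlKernel (c - d) (s - r)‖ₑ * ‖f r‖ₑ) := by
  obtain ⟨C, hC, h⟩ := exists_enorm_rlKernel_le (c - d) c T (sub_pos.2 hd)
  refine ⟨C, hC, fun a ha τ hτ x f hf s hs => ?_⟩
  have hca : c - a ∈ Set.Icc (c - d) c := ⟨by linarith [ha.2], by linarith [ha.1]⟩
  rw [rlConvDirac, mul_add, ← lintegral_const_mul' _ _ hC]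
  refine (enorm_add_le _ _).trans (add_le_add ?_ ((enorm_rlConv_le _ _ _).trans ?_))
  · rw [enorm_smul, ← mul_assoc]
    exact mul_le_mul_left (h _ hca _ (by linarith)) _
  · refine lintegral_mono fun r => ?_
    simp only
    rcases le_or_gt r 0 with hr | hr
    · simp [hf r hr]
    · rw [← mul_assoc]
      exact mul_le_mul_left (h _ hca _ (by linarith)) _

lemma distConv_eq_zero {lam : Measure ℝ} {B : ℝ → X →L[ℝ] X} {c τ t : ℝ} {x : X}
    {f : ℝ → X} (hf : ∀ s ≤ τ, f s = 0) (ht : t ≤ τ) :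
    distConv lam B c τ x f t = 0 := by
  simp [distConv, rlConvDirac, rlConv_eq_zero hf ht, rlKernel_of_nonpos (sub_nonpos.2 ht)]

section

variable {lam : Measure ℝ} [IsFiniteMeasure lam] {B : ℝ → X →L[ℝ] X} {CB : ℝ≥0∞} {d : ℝ}

lemma exists_lintegral_enorm_le (hB : ∀ a x, ‖B a x‖ₑ ≤ CB * ‖x‖ₑ) (hCB : CB ≠ ∞)
    (hlam : ∀ᵐ a ∂lam, a ∈ Set.Icc 0 d) (c T : ℝ) (hd : d < c) :
    ∃ C : ℝ≥0∞, C ≠ ∞ ∧ ∀ τ, 0 ≤ τ → ∀ (x : X) (f : ℝ → X),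
      (∀ s ≤ 0, f s = 0) → ∀ s ≤ T, ∫⁻ a, ‖B a (rlConvDirac (c - a) τ x f s)‖ₑ ∂lam ≤
        C * (‖rlKernel (c - d) (s - τ)‖ₑ * ‖x‖ₑ + ∫⁻ r, ‖rlKernel (c - d) (s - r)‖ₑ * ‖f r‖ₑ) := by
  obtain ⟨C, hC, h⟩ := exists_enorm_rlConvDirac_le (X := X) c d T hd
  refine ⟨CB * C * lam Set.univ,
    ENNReal.mul_ne_top (ENNReal.mul_ne_top hCB hC) (measure_ne_top _ _),
    fun τ hτ x f hf s hs => ?_⟩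
  calc ∫⁻ a, ‖B a (rlConvDirac (c - a) τ x f s)‖ₑ ∂lam
      ≤ ∫⁻ _, CB * (C * (‖rlKernel (c - d) (s - τ)‖ₑ * ‖x‖ₑ
          + ∫⁻ r, ‖rlKernel (c - d) (s - r)‖ₑ * ‖f r‖ₑ)) ∂lam := by
        refine lintegral_mono_ae ?_
        filter_upwards [hlam] with a ha
        exact (hB a _).trans (mul_le_mul_right (h a ha τ hτ x f hf s hs) _)
    _ = _ := by
        rw [lintegral_const]
        ring

lemma integrable_rlKernel_smul_apply_rlConvDirac
    (hB : ∀ a x, ‖B a x‖ₑ ≤ CB * ‖x‖ₑ) (hCB : CB ≠ ∞) (hBc : Continuous fun p : ℝ × X => B p.1 p.2)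
    (hlam : ∀ᵐ a ∂lam, a ∈ Set.Icc 0 d)
    {a₀ c τ : ℝ} (ha : 0 < a₀) (hd : d < c)
    (hac : 1 ≤ a₀ + (c - d)) (hτ : 0 ≤ τ) (x : X) {f : ℝ → X} (hf : CausalLocInt f) (t : ℝ) :
    Integrable (Function.uncurry fun s a =>
      rlKernel a₀ (t - s) • B a (rlConvDirac (c - a) τ x f s)) (volume.prod lam) := by
  have hmB : AEStronglyMeasurable (fun p : ℝ × ℝ => B p.2 (rlConvDirac (c - p.2) τ x f p.1))
      (volume.prod lam) :=
    hBc.comp_aestronglyMeasurable ((Measurable.aestronglyMeasurable (by fun_prop)).prodMk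
      (aestronglyMeasurable_rlConvDirac lam c τ x hf.aestronglyMeasurable))
  have hm : AEStronglyMeasurable (Function.uncurry fun s a =>
      rlKernel a₀ (t - s) • B a (rlConvDirac (c - a) τ x f s)) (volume.prod lam) :=
    AEStronglyMeasurable.smul (Measurable.aestronglyMeasurable (by fun_prop)) hmB
  refine ⟨hm, ?_⟩
  obtain ⟨C, hC, h⟩ := exists_lintegral_enorm_le (X := X) hB hCB hlam c t hd
  have hcd : 0 < c - d := sub_pos.2 hd
  rw [HasFiniteIntegral, lintegral_prod _ hm.enorm]
  calc _ ≤ ∫⁻ s, C * (‖rlKernel a₀ (t - s)‖ₑ * ‖rlKernel (c - d) (s - τ)‖ₑ * ‖x‖ₑ +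
        ‖rlKernel a₀ (t - s)‖ₑ * ∫⁻ r, ‖rlKernel (c - d) (s - r)‖ₑ * ‖f r‖ₑ) := by
        refine lintegral_mono fun s => ?_
        simp only [Function.uncurry, enorm_smul]
        rw [lintegral_const_mul' _ _ enorm_ne_top]
        rcases le_or_gt t s with hs | hs
        · simp [rlKernel_of_nonpos (sub_nonpos.2 hs)]
        · refine (mul_le_mul_right (h τ hτ x f hf.eq_zero s hs.le) _).trans (le_of_eq ?_)
          ring
    _ = C * (‖rlKernel (a₀ + (c - d)) (t - τ)‖ₑ * ‖x‖ₑ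
          + ∫⁻ r, ‖rlKernel (a₀ + (c - d)) (t - r)‖ₑ * ‖f r‖ₑ) := by
        rw [lintegral_const_mul' _ _ hC, lintegral_add_left' (by fun_prop),
          lintegral_mul_const _ (by fun_prop), lintegral_rlKernel_mul ha hcd,
          lintegral_rlKernel_assoc ha hcd hf.aestronglyMeasurable.enorm]
    _ < ∞ := by
        refine ENNReal.mul_lt_top hC.lt_top (ENNReal.add_lt_top.2
          ⟨ENNReal.mul_lt_top enorm_lt_top enorm_lt_top, ?_⟩)
        exact (integrable_rlKernel_smul_iff hf.aestronglyMeasurable).1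
          (hf.integrable_rlKernel_smul hac t)

variable [CompleteSpace X]

lemma integrable_rlKernel_smul_distConv_and_eq
    (hB : ∀ a x, ‖B a x‖ₑ ≤ CB * ‖x‖ₑ) (hCB : CB ≠ ∞) (hBc : Continuous fun p : ℝ × X => B p.1 p.2)
    (hlam : ∀ᵐ a ∂lam, a ∈ Set.Icc 0 d)
    {a₀ c τ : ℝ} (ha : 0 < a₀) (hd : d < c)
    (hac : 1 ≤ a₀ + (c - d)) (hτ : 0 ≤ τ) (x : X) {f : ℝ → X} (hf : CausalLocInt f) (t : ℝ) :
    Integrable (fun s => rlKernel a₀ (t - s) • distConv lam B c τ x f s) ∧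
      rlConv a₀ (distConv lam B c τ x f) t = distConv lam B (a₀ + c) τ x f t := by
  have hprod := integrable_rlKernel_smul_apply_rlConvDirac hB hCB hBc hlam ha hd hac hτ x hf t
  have e1 : ∀ s, rlKernel a₀ (t - s) • distConv lam B c τ x f s
      = ∫ a, rlKernel a₀ (t - s) • B a (rlConvDirac (c - a) τ x f s) ∂lam := fun s => by
    rw [distConv, ← MeasureTheory.integral_smul]
  constructor
  · simp_rw [e1]
    exact hprod.integral_prod_left
  · rw [rlConv]
    simp_rw [e1]
    rw [integral_integral_swap hprod, distConv]
    refine integral_congr_ae ?_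
    filter_upwards [hlam] with a hla
    have hca : 0 < c - a := by linarith [hla.2]
    have hac' : 1 ≤ a₀ + (c - a) := by linarith [hla.2]
    rw [add_sub_assoc, ← hf.rlConv_rlConvDirac ha hca hac' x t, rlConv,
      ← ContinuousLinearMap.integral_comp_comm]
    · simp_rw [map_smul]
    · simp_rw [rlConvDirac, smul_add]
      exact (integrable_rlKernel_smul_rlKernel_smul ha hca τ x t).add
        (integrable_rlKernel_smul_rlConv_and_eq ha hca hf.aestronglyMeasurable
          (hf.integrable_rlKernel_smul hac' t)).1

lemma causalLocInt_distConv
    (hB : ∀ a x, ‖B a x‖ₑ ≤ CB * ‖x‖ₑ) (hCB : CB ≠ ∞) (hBc : Continuous fun p : ℝ × X => B p.1 p.2)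
    (hlam : ∀ᵐ a ∂lam, a ∈ Set.Icc 0 d)
    {c τ : ℝ} (hd : d < c) (hτ : 0 ≤ τ) (x : X) {f : ℝ → X}
    (hf : CausalLocInt f) : CausalLocInt (distConv lam B c τ x f) where
  eq_zero s hs := by
    simp [distConv, rlConvDirac, rlConv_eq_zero hf.eq_zero hs,
      rlKernel_of_nonpos (show s - τ ≤ 0 by linarith)]
  integrableOn T := by
    have := (integrable_rlKernel_smul_distConv_and_eq hB hCB hBc hlam one_pos hd (by linarith)
      hτ x hf T).1
    rwa [rlKernel_one_smul, integrable_indicator_iff measurableSet_Iio] at this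

lemma exists_lintegral_le_of_distConv_eq
    (hB : ∀ a x, ‖B a x‖ₑ ≤ CB * ‖x‖ₑ) (hCB : CB ≠ ∞) (hBc : Continuous fun p : ℝ × X => B p.1 p.2)
    (hlam : ∀ᵐ a ∂lam, a ∈ Set.Icc 0 d)
    {c a₀ : ℝ} (hd : d < c) (ha : 0 < a₀) (ha1 : a₀ < 1)
    (hac : a₀ + (c - d) = 1) (T : ℝ) :
    ∃ K : ℝ≥0∞, K ≠ ∞ ∧ ∀ τ, 0 ≤ τ → ∀ (x : X) (f : ℝ → X), CausalLocInt f → StronglyMeasurable f →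
      (∀ s ≤ τ, f s = 0) → (∀ t, Integrable fun s => rlKernel a₀ (t - s) • f s) →
      (∀ t, τ < t → rlConv a₀ f t + distConv lam B (a₀ + c) τ x f t = 0) →
      ∀ t ≤ T, ∫⁻ s, ‖rlKernel a₀ (t - s)‖ₑ * ‖f s‖ₑ ≤ K * ‖x‖ₑ := by
  have hcd : 0 < c - d := sub_pos.2 hd
  obtain ⟨C, hC, hbound⟩ := exists_lintegral_enorm_le (X := X) hB hCB hlam c T hd
  obtain ⟨C', hC', hgron⟩ := exists_lintegral_le_of_le_rlKernel hcd hC T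
  refine ⟨C * (1 + C'), ENNReal.mul_ne_top hC (by simp [hC']), ?_⟩
  intro τ hτ x f hf hfm hsupp hi heq t ht
  have hQ := causalLocInt_distConv hB hCB hBc hlam hd hτ x hf
  have hz0 : ∀ t, rlConv a₀ (fun s => f s + distConv lam B c τ x f s) t = 0 := by
    intro t
    rcases le_or_gt t τ with h | h
    · exact rlConv_eq_zero
        (fun s hs => by rw [hsupp s hs, distConv_eq_zero hsupp hs, add_zero]) h
    · obtain ⟨h1, h2⟩ := integrable_rlKernel_smul_distConv_and_eq hB hCB hBc hlam ha hd hac.ge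
        hτ x hf t
      rw [← heq t h, ← h2]
      simp_rw [rlConv, smul_add]
      exact integral_add (hi t) h1
  have hz := (hf.add hQ).ae_eq_zero_of_rlConv_eq_zero ha ha1 hz0
  have hle : ∀ᵐ s, s < T → ‖f s‖ₑ ≤
      C * (‖rlKernel (c - d) (s - τ)‖ₑ * ‖x‖ₑ + ∫⁻ r, ‖rlKernel (c - d) (s - r)‖ₑ * ‖f r‖ₑ) := by
    filter_upwards [hz] with s hs hsT
    rw [eq_neg_of_add_eq_zero_left hs, enorm_neg]
    exact (enorm_integral_le_lintegral_enorm _).trans (hbound τ hτ x f hf.eq_zero s hsT.le)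
  have hL1 := hgron τ hτ ‖x‖ₑ (fun s => ‖f s‖ₑ) hfm.enorm (hf.integrableOn T).2.ne
    (fun s hs => by simp [hsupp s hs]) hle
  have hone : ∀ r, ‖rlKernel 1 r‖ₑ ≤ 1 := fun r => by
    rcases le_or_gt r 0 with h | h
    · simp [rlKernel_of_nonpos h]
    · simp [rlKernel_one_of_pos h]
  calc ∫⁻ s, ‖rlKernel a₀ (t - s)‖ₑ * ‖f s‖ₑ
      ≤ ∫⁻ s, C * (‖rlKernel a₀ (t - s)‖ₑ * ‖rlKernel (c - d) (s - τ)‖ₑ * ‖x‖ₑ +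
        ‖rlKernel a₀ (t - s)‖ₑ * ∫⁻ r, ‖rlKernel (c - d) (s - r)‖ₑ * ‖f r‖ₑ) := by
        refine lintegral_mono_ae ?_
        filter_upwards [hle] with s hs
        rcases le_or_gt t s with hst | hst
        · simp [rlKernel_of_nonpos (sub_nonpos.2 hst)]
        · refine (mul_le_mul_right (hs (hst.trans_le ht)) _).trans (le_of_eq ?_)
          ring
    _ = C * (‖rlKernel 1 (t - τ)‖ₑ * ‖x‖ₑ + ∫⁻ r, ‖rlKernel 1 (t - r)‖ₑ * ‖f r‖ₑ) := by
        rw [lintegral_const_mul' _ _ hC, lintegral_add_left' (by fun_prop),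
          lintegral_mul_const _ (by fun_prop), lintegral_rlKernel_mul ha hcd,
          lintegral_rlKernel_assoc ha hcd hfm.aestronglyMeasurable.enorm, hac]
    _ ≤ C * (1 * ‖x‖ₑ + C' * ‖x‖ₑ) := by
        refine mul_le_mul_right (add_le_add (mul_le_mul_left (hone _) _) (le_trans ?_ hL1)) _
        rw [← lintegral_indicator measurableSet_Iio]
        refine lintegral_mono fun r => ?_
        simp only
        rcases le_or_gt t r with h | h
        · simp [rlKernel_of_nonpos (sub_nonpos.2 h)]
        · rw [Set.indicator_of_mem (show r ∈ Set.Iio T from h.trans_le ht)]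
          exact mul_le_of_le_one_left' (hone _)
    _ = _ := by ring

end

end

section

variable {X : Type*} [NormedAddCommGroup X] [NormedSpace ℝ X]

lemma caputoD_natCast (k : ℕ) (τ : ℝ) (g : ℝ → X) (t : ℝ) :
    caputoD (k : ℝ) τ g t = iteratedDeriv k g t := by
  simp [caputoD]

lemma caputoD_eq_rlConv {a τ t : ℝ} (ha : a ≠ (⌈a⌉₊ : ℝ)) (g : ℝ → X) (h : τ ≤ t) :
    caputoD a τ g t
      = rlConv ((⌈a⌉₊ : ℝ) - a) ((Set.Ioi τ).indicator (iteratedDeriv ⌈a⌉₊ g)) t := by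
  rw [caputoD, if_neg ha, ← fracInt_eq_rlConv _ h, fracInt]

lemma natCeil_eq_of_lt {m : ℕ} (hm : 0 < m) {μ : ℝ} (hμ1 : (m : ℝ) - 1 < μ) (hμ2 : μ < m) :
    ⌈μ⌉₊ = m := by
  rw [Nat.ceil_eq_iff hm.ne', Nat.cast_pred hm]
  exact ⟨hμ1, hμ2.le⟩

lemma rlConvDirac_eq_zero {f : ℝ → X} {a τ t : ℝ} {x : X} (hf : ∀ s ≤ τ, f s = 0) (ht : t ≤ τ) :
    rlConvDirac a τ x f t = 0 := by
  simp [rlConvDirac, rlConv_eq_zero hf ht, rlKernel_of_nonpos (sub_nonpos.2 ht)]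

lemma integral_eq_rlConv_one {τ t : ℝ} (g : ℝ → X) (h : τ ≤ t) :
    ∫ s in τ..t, g s = rlConv 1 ((Set.Ioi τ).indicator g) t := by
  simp [← fracInt_eq_rlConv _ h, fracInt]

lemma integrable_rlKernel_smul_indicator {g : ℝ → X} (hg : Continuous g) {a : ℝ} (ha : 0 < a)
    (τ t : ℝ) : Integrable fun s => rlKernel a (t - s) • (Set.Ioi τ).indicator g s := by
  obtain ⟨M, hM⟩ := (isCompact_Icc (a := τ) (b := t)).exists_bound_of_continuousOn hg.continuousOn
  refine Integrable.mono' ((integrable_rlKernel_mul ha one_pos t τ).const_mul M)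
    (aestronglyMeasurable_rlKernel_smul
      (hg.aestronglyMeasurable.indicator measurableSet_Ioi) a t) (Eventually.of_forall fun s => ?_)
  rw [norm_smul, Real.norm_of_nonneg (rlKernel_nonneg ha _)]
  rcases le_or_gt t s with h | h
  · simp [rlKernel_of_nonpos (sub_nonpos.2 h)]
  rcases le_or_gt s τ with h1 | h1
  · simp [rlKernel_of_nonpos (sub_nonpos.2 h1), h1]
  · rw [rlKernel_one_of_pos (sub_pos.2 h1), Set.indicator_of_mem (show s ∈ Set.Ioi τ from h1),
      mul_one, mul_comm]
    exact mul_le_mul_of_nonneg_right (hM s ⟨h1.le, h.le⟩) (rlKernel_nonneg ha _)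

lemma causalLocInt_indicator {g : ℝ → X} (hg : Continuous g) {τ : ℝ} (hτ : 0 ≤ τ) :
    CausalLocInt ((Set.Ioi τ).indicator g) where
  eq_zero s hs := by simp [hs.trans hτ]
  integrableOn T := by
    have := integrable_rlKernel_smul_indicator hg one_pos τ T
    rwa [rlKernel_one_smul, integrable_indicator_iff measurableSet_Iio] at this

variable [CompleteSpace X]

lemma caputoD_eq_rlConvDirac {m : ℕ} (hm : 0 < m) {τ : ℝ} {x : X} {f v : ℝ → X}
    (hf : CausalLocInt f) (hsupp : ∀ s ≤ τ, f s = 0)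
    (hv : ∀ k < m, ∀ t, τ < t → iteratedDeriv k v t = rlConvDirac ((m : ℝ) - k) τ x f t)
    {a : ℝ} (ha : a ∈ Set.Icc (0 : ℝ) ((m : ℝ) - 1)) {t : ℝ} (ht : τ < t) :
    caputoD a τ v t = rlConvDirac ((m : ℝ) - a) τ x f t := by
  have hk : ⌈a⌉₊ < m := by
    have : ⌈a⌉₊ ≤ m - 1 := by
      rw [Nat.ceil_le, Nat.cast_pred hm]
      exact ha.2
    omega
  by_cases h : a = (⌈a⌉₊ : ℝ)
  · rw [h, caputoD_natCast, hv _ hk t ht]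
  · have hpos : 0 < (⌈a⌉₊ : ℝ) - a := sub_pos.2 (lt_of_le_of_ne (Nat.le_ceil a) h)
    have hmk : 0 < (m : ℝ) - ⌈a⌉₊ := sub_pos.2 (by exact_mod_cast hk)
    rw [caputoD_eq_rlConv h v ht.le, show (m : ℝ) - a = ((⌈a⌉₊ : ℝ) - a) + ((m : ℝ) - ⌈a⌉₊) by ring,
      ← hf.rlConv_rlConvDirac hpos hmk (by linarith [ha.2])]
    congr 1
    ext s
    by_cases hs : τ < s
    · rw [Set.indicator_of_mem (show s ∈ Set.Ioi τ from hs), hv _ hk s hs]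
    · rw [Set.indicator_of_notMem (show s ∉ Set.Ioi τ from hs),
        rlConvDirac_eq_zero hsupp (not_lt.1 hs)]

lemma iteratedDeriv_eq_rlConvDirac {m : ℕ} {τ : ℝ} (hτ : 0 ≤ τ) {x : X} {v : ℝ → X}
    (hv : ContDiff ℝ m v)
    (h0 : ∀ k, k + 1 < m → Tendsto (fun t => iteratedDeriv k v t) (𝓝[>] τ) (𝓝 0))
    (h1 : Tendsto (fun t => iteratedDeriv (m - 1) v t) (𝓝[>] τ) (𝓝 x)) :
    ∀ k < m, ∀ t, τ < t → iteratedDeriv k v t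
      = rlConvDirac ((m : ℝ) - k) τ x ((Set.Ioi τ).indicator (iteratedDeriv m v)) t := by
  have hcont : ∀ k ≤ m, Continuous (iteratedDeriv k v) := fun k hk =>
    hv.continuous_iteratedDeriv k (by exact_mod_cast hk)
  have hval : ∀ k ≤ m, ∀ y, Tendsto (fun t => iteratedDeriv k v t) (𝓝[>] τ) (𝓝 y) →
      iteratedDeriv k v τ = y := fun k hk y hy =>
    tendsto_nhds_unique ((hcont k hk).continuousAt.tendsto.mono_left nhdsWithin_le_nhds) hy
  have hftc : ∀ k < m, ∀ t, τ < t → iteratedDeriv k v t = iteratedDeriv k v τ +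
      rlConv 1 ((Set.Ioi τ).indicator (iteratedDeriv (k + 1) v)) t := fun k hk t ht => by
    rw [← integral_eq_rlConv_one _ ht.le, integral_eq_sub_of_hasDerivAt
      (f := iteratedDeriv k v) (fun s _ => ?_) ((hcont (k + 1) hk).intervalIntegrable _ _)]
    · abel
    · rw [iteratedDeriv_succ]
      exact ((hv.differentiable_iteratedDeriv k (by exact_mod_cast hk)) s).hasDerivAt
  set f := (Set.Ioi τ).indicator (iteratedDeriv m v) with hfdef
  have hf : CausalLocInt f := causalLocInt_indicator (hcont m le_rfl) hτ
  suffices H : ∀ j k, k + j + 1 = m → ∀ t, τ < t →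
      iteratedDeriv k v t = rlConvDirac ((m : ℝ) - k) τ x f t from
    fun k hk => H (m - 1 - k) k (by omega)
  intro j
  induction j with
  | zero =>
    intro k hk t ht
    subst hk
    rw [hftc k (by omega) t ht, hval k (by omega) x (by simpa using h1), rlConvDirac]
    simp [rlKernel_one_of_pos (sub_pos.2 ht), hfdef]
  | succ j ih =>
    intro k hk t ht
    have hpos : (1 : ℝ) ≤ (m : ℝ) - (k + 1 : ℕ) := by
      rw [← hk]; push_cast; linarith [(Nat.cast_nonneg j : (0 : ℝ) ≤ j)]
    rw [hftc k (by omega) t ht, hval k (by omega) 0 (h0 k (by omega)), zero_add,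
      show (m : ℝ) - k = 1 + ((m : ℝ) - (k + 1 : ℕ)) by push_cast; ring,
      ← hf.rlConv_rlConvDirac one_pos (by linarith) (by linarith)]
    congr 1
    ext s
    by_cases hs : τ < s
    · rw [Set.indicator_of_mem (show s ∈ Set.Ioi τ from hs), ih (k + 1) (by omega) s hs]
    · rw [Set.indicator_of_notMem (show s ∉ Set.Ioi τ from hs),
        rlConvDirac_eq_zero (fun s hs => by simp [f, hs]) (not_lt.1 hs)]

section

variable {m : ℕ} {G : ℝ → X}

lemma CausalLocInt.hasDerivAt_rlConv_sub (hG : CausalLocInt G)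
    {k : ℕ} (hk : k + 1 < m) (t : ℝ) :
    HasDerivAt (rlConv ((m : ℝ) - k) G) (rlConv ((m : ℝ) - (k + 1 : ℕ)) G t) t := by
  have h : (1 : ℝ) ≤ (m : ℝ) - (k + 1 : ℕ) := by
    have : ((k + 1 : ℕ) : ℝ) + 1 ≤ m := by exact_mod_cast hk
    linarith
  have := hG.hasDerivAt_rlConv h t
  rwa [show (m : ℝ) - (k + 1 : ℕ) + 1 = m - k by push_cast; ring] at this

lemma CausalLocInt.iteratedDeriv_rlConv (hG : CausalLocInt G)
    {k : ℕ} (hk : k < m) :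
    iteratedDeriv k (rlConv (m : ℝ) G) = rlConv ((m : ℝ) - k) G := by
  induction k with
  | zero => simp
  | succ k ih =>
    rw [iteratedDeriv_succ, ih (by omega)]
    exact funext fun t => (hG.hasDerivAt_rlConv_sub hk t).deriv

lemma CausalLocInt.iteratedDerivWithin_rlConv (hG : CausalLocInt G)
    {k : ℕ} (hk : k < m) :
    Set.EqOn (iteratedDerivWithin k (rlConv (m : ℝ) G) (Set.Ici 0)) (rlConv ((m : ℝ) - k) G)
      (Set.Ici 0) := by
  induction k with
  | zero => intro t _; simp
  | succ k ih =>
    intro t ht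
    rw [iteratedDerivWithin_succ, derivWithin_congr (ih (by omega)) (ih (by omega) ht)]
    exact (hG.hasDerivAt_rlConv_sub hk t).hasDerivWithinAt.derivWithin (uniqueDiffOn_Ici 0 t ht)

lemma CausalLocInt.ae_iteratedDeriv_rlConv (hG : CausalLocInt G)
    (hm : 0 < m) :
    ∀ᵐ t, iteratedDeriv m (rlConv (m : ℝ) G) t = G t := by
  filter_upwards [hG.ae_hasDerivAt_rlConv_one] with t ht
  obtain ⟨k, rfl⟩ := Nat.exists_eq_add_one.2 hm
  rw [iteratedDeriv_succ, hG.iteratedDeriv_rlConv k.lt_succ_self]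
  simpa using ht.deriv

lemma caputoD_eq_of_eq_rlConv (hG : CausalLocInt G)
    (hm : 0 < m) {μ : ℝ} (hμ1 : (m : ℝ) - 1 < μ) (hμ2 : μ < m)
    {u : ℝ → X} (hu : ∀ t, 0 ≤ t → u t = rlConv (m : ℝ) G t) {t : ℝ} (ht : 0 < t) :
    caputoD μ 0 u t = rlConv ((m : ℝ) - μ) G t := by
  have hceil := natCeil_eq_of_lt hm hμ1 hμ2
  rw [caputoD_eq_rlConv (by rw [hceil]; exact hμ2.ne) u ht.le, hceil]
  refine rlConv_congr_ae ?_
  filter_upwards [hG.ae_iteratedDeriv_rlConv hm] with s hs _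
  rcases le_or_gt s 0 with h | h
  · rw [hG.eq_zero s h, Set.indicator_of_notMem (by simpa using h)]
  · rw [Set.indicator_of_mem (show s ∈ Set.Ioi 0 from h), ← hs]
    refine Filter.EventuallyEq.iteratedDeriv_eq m ?_
    filter_upwards [Ioi_mem_nhds h] with r hr using hu r (Set.mem_Ioi.1 hr).le

lemma iteratedDeriv_eq_of_eq_rlConv (hG : CausalLocInt G)
    {u : ℝ → X} (hu : ∀ t, 0 ≤ t → u t = rlConv (m : ℝ) G t)
    {k : ℕ} (hk : k < m) {t : ℝ} (ht : 0 < t) :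
    iteratedDeriv k u t = rlConv ((m : ℝ) - k) G t := by
  rw [← hG.iteratedDeriv_rlConv hk]
  refine Filter.EventuallyEq.iteratedDeriv_eq k ?_
  filter_upwards [Ioi_mem_nhds ht] with r hr using hu r (Set.mem_Ioi.1 hr).le

lemma iteratedDerivWithin_eq_zero_of_eq_rlConv (hG : CausalLocInt G)
    {u : ℝ → X}
    (hu : ∀ t, 0 ≤ t → u t = rlConv (m : ℝ) G t) {k : ℕ} (hk : k < m) :
    iteratedDerivWithin k u (Set.Ici 0) 0 = 0 := by
  have hEq : Set.EqOn u (rlConv (m : ℝ) G) (Set.Ici 0) := fun t ht => hu t ht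
  rw [iteratedDerivWithin_congr hEq Set.self_mem_Ici,
    hG.iteratedDerivWithin_rlConv hk Set.self_mem_Ici, rlConv_eq_zero hG.eq_zero le_rfl]

end

end

section

variable {X : Type*} [NormedAddCommGroup X] [NormedSpace ℝ X]

lemma exists_continuous_extension_Icc {d : ℝ} (hd : 0 ≤ d) {B : ℝ → X →L[ℝ] X}
    (hB : ∀ x : X, ContinuousOn (fun a => B a x) (Set.Icc 0 d))
    (hC : ∃ C : ℝ, ∀ a ∈ Set.Icc 0 d, ‖B a‖ ≤ C) :
    ∃ B' : ℝ → X →L[ℝ] X, ∃ C : ℝ≥0∞, C ≠ ∞ ∧ (∀ a ∈ Set.Icc 0 d, B' a = B a) ∧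
      (∀ a x, ‖B' a x‖ₑ ≤ C * ‖x‖ₑ) ∧ Continuous fun p : ℝ × X => B' p.1 p.2 := by
  obtain ⟨C, hC⟩ := hC
  set π : ℝ → ℝ := fun a => Set.projIcc 0 d hd a with hπ
  have hmem : ∀ a, π a ∈ Set.Icc 0 d := fun a => (Set.projIcc 0 d hd a).2
  have hcont : Continuous π := continuous_subtype_val.comp continuous_projIcc
  have hC0 : 0 ≤ C := (norm_nonneg _).trans (hC _ (hmem 0))
  have hnorm : ∀ a x, ‖B (π a) x‖ ≤ C * ‖x‖ := fun a x =>
    ((B (π a)).le_opNorm x).trans (by gcongr; exact hC _ (hmem a))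
  refine ⟨fun a => B (π a), ENNReal.ofReal C, ENNReal.ofReal_ne_top, fun a ha => ?_,
    fun a x => ?_, ?_⟩
  · simp [hπ, Set.projIcc_of_mem hd ha]
  · rw [← ofReal_norm, ← ofReal_norm, ← ENNReal.ofReal_mul hC0]
    exact ENNReal.ofReal_le_ofReal (hnorm a x)
  · refine continuous_prod_of_continuous_lipschitzWith' _ C.toNNReal (fun a => ?_) (fun x => ?_)
    swap
    · exact (hB x).comp_continuous hcont hmem
    · refine LipschitzWith.of_dist_le_mul fun x y => ?_
      rw [dist_eq_norm, dist_eq_norm, ← map_sub, Real.coe_toNNReal _ hC0]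
      exact hnorm a _

lemma rlConvDirac_zero (a τ : ℝ) (f : ℝ → X) (t : ℝ) : rlConvDirac a τ 0 f t = rlConv a f t := by
  simp [rlConvDirac]

variable [CompleteSpace X]

lemma indicator_Ioi_eq_rlConvDirac {h : ℝ → X} (hh : ContDiff ℝ 1 h) (t : ℝ) :
    (Set.Ioi 0).indicator h t = rlConvDirac 1 0 (h 0) ((Set.Ioi 0).indicator (deriv h)) t := by
  have hd : Continuous (deriv h) := hh.continuous_deriv le_rfl
  rcases le_or_gt t 0 with ht | ht
  · rw [Set.indicator_of_notMem (by simpa using ht),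
      rlConvDirac_eq_zero (fun s hs => Set.indicator_of_notMem (by simpa using hs) _) ht]
  · rw [Set.indicator_of_mem (show t ∈ Set.Ioi 0 from ht), rlConvDirac, sub_zero,
      rlKernel_one_of_pos ht, one_smul, ← integral_eq_rlConv_one _ ht.le,
      integral_deriv_eq_sub (fun s _ => hh.differentiable (by simp) s)
        (hd.intervalIntegrable _ _)]
    abel

lemma ae_rlDeriv_eq {h : ℝ → X} (hh : ContDiff ℝ 1 h) {a : ℝ} (ha1 : a < 1) :
    ∀ᵐ t, (Set.Ioi 0).indicator (rlDeriv a 0 h) t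
      = rlConvDirac (1 - a) 0 (h 0) ((Set.Ioi 0).indicator (deriv h)) t := by
  have hf : CausalLocInt ((Set.Ioi 0).indicator (deriv h)) :=
    causalLocInt_indicator (hh.continuous_deriv le_rfl) le_rfl
  have hb : 0 < 1 - a := by linarith
  have hq := hf.convDirac hb le_rfl (h 0)
  have key : ∀ t, rlConv (1 - a) ((Set.Ioi 0).indicator h) t
      = rlConv 1 (rlConvDirac (1 - a) 0 (h 0) ((Set.Ioi 0).indicator (deriv h))) t := by
    intro t
    rw [hf.rlConv_rlConvDirac one_pos hb (by linarith), add_comm,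
      ← hf.rlConv_rlConvDirac hb one_pos (by linarith)]
    congr 1
    exact funext (indicator_Ioi_eq_rlConvDirac hh)
  filter_upwards [hq.ae_hasDerivAt_rlConv_one] with t ht
  rcases le_or_gt t 0 with h0 | h0
  · rw [Set.indicator_of_notMem (by simpa using h0), hq.eq_zero t h0]
  · rw [Set.indicator_of_mem (show t ∈ Set.Ioi 0 from h0), rlDeriv]
    refine (ht.congr_of_eventuallyEq ?_).deriv
    filter_upwards [Ioi_mem_nhds h0] with r hr
    rw [fracInt_eq_rlConv _ (Set.mem_Ioi.1 hr).le, key]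

lemma causalLocInt_rlDeriv {h : ℝ → X} (hh : ContDiff ℝ 1 h) {a : ℝ} (ha1 : a < 1) :
    CausalLocInt ((Set.Ioi 0).indicator (rlDeriv a 0 h)) where
  eq_zero s hs := Set.indicator_of_notMem (by simpa using hs) _
  integrableOn T := by
    have hf : CausalLocInt ((Set.Ioi 0).indicator (deriv h)) :=
      causalLocInt_indicator (hh.continuous_deriv le_rfl) le_rfl
    exact ((hf.convDirac (show 0 < 1 - a by linarith) le_rfl (h 0)).integrableOn T).congr
      (ae_restrict_of_ae ((ae_rlDeriv_eq hh ha1).mono fun _ h => h.symm))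

lemma integrable_rlKernel_smul_rlDeriv {h : ℝ → X} (hh : ContDiff ℝ 1 h) {a : ℝ} (ha0 : 0 < a)
    (ha1 : a < 1) (t : ℝ) :
    Integrable fun s => rlKernel a (t - s) • (Set.Ioi 0).indicator (rlDeriv a 0 h) s := by
  have hf : CausalLocInt ((Set.Ioi 0).indicator (deriv h)) :=
    causalLocInt_indicator (hh.continuous_deriv le_rfl) le_rfl
  have hb : 0 < 1 - a := by linarith
  refine ((integrable_rlKernel_smul_rlKernel_smul ha0 hb 0 (h 0) t).add
    (integrable_rlKernel_smul_rlConv_and_eq ha0 hb hf.aestronglyMeasurable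
      (hf.integrable_rlKernel_smul (by linarith) t)).1).congr ?_
  filter_upwards [ae_rlDeriv_eq hh ha1] with s hs
  rw [hs, rlConvDirac, smul_add]; rfl

lemma rlConv_rlDeriv {h : ℝ → X} (hh : ContDiff ℝ 1 h) {a : ℝ} (ha0 : 0 < a)
    (ha1 : a < 1) {t : ℝ} (ht : 0 < t) :
    rlConv a ((Set.Ioi 0).indicator (rlDeriv a 0 h)) t = h t := by
  have hf : CausalLocInt ((Set.Ioi 0).indicator (deriv h)) :=
    causalLocInt_indicator (hh.continuous_deriv le_rfl) le_rfl
  rw [rlConv_congr_ae ((ae_rlDeriv_eq hh ha1).mono fun s hs _ => hs),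
    hf.rlConv_rlConvDirac ha0 (by linarith) (by linarith), add_sub_cancel,
    ← indicator_Ioi_eq_rlConvDirac hh, Set.indicator_of_mem (show t ∈ Set.Ioi 0 from ht)]

end

section

variable {X : Type*} [NormedAddCommGroup X]

/-- A measurable family of densities `Y τ` supported in `(τ, ∞)`, `τ > 0`, whose fractional
integrals of order `a₀` are dominated by a causal weight `W`. -/
structure DominatedFamily (a₀ : ℝ) (W : ℝ → X) (Y : ℝ → ℝ → X) : Prop where
  causal : CausalLocInt W
  stronglyMeasurable : StronglyMeasurable (Function.uncurry Y)
  eq_zero_of_nonpos : ∀ τ ≤ 0, ∀ s, Y τ s = 0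
  eq_zero_of_le : ∀ τ s, s ≤ τ → Y τ s = 0
  bound : ∀ t, ∃ K : ℝ≥0∞, K ≠ ∞ ∧ ∀ τ, ∫⁻ s, ‖rlKernel a₀ (t - s)‖ₑ * ‖Y τ s‖ₑ ≤ K * ‖W τ‖ₑ

namespace DominatedFamily

variable {a₀ : ℝ} {W : ℝ → X} {Y : ℝ → ℝ → X}

lemma eq_zero_of_time_nonpos (H : DominatedFamily a₀ W Y) (τ : ℝ) {s : ℝ} (hs : s ≤ 0) :
    Y τ s = 0 := by
  rcases le_or_gt τ 0 with h | h
  · exact H.eq_zero_of_nonpos τ h s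
  · exact H.eq_zero_of_le τ s (hs.trans h.le)

variable [NormedSpace ℝ X]

lemma integrable (H : DominatedFamily a₀ W Y) (h₀ : 0 < a₀) {a : ℝ} (ha : a₀ ≤ a) (t : ℝ) :
    Integrable (Function.uncurry fun τ s => rlKernel a (t - s) • Y τ s) := by
  obtain ⟨C, hC, hCb⟩ := exists_enorm_rlKernel_le a₀ a t h₀
  obtain ⟨K, hK, hKb⟩ := H.bound t
  have hmeas : StronglyMeasurable (Function.uncurry fun τ s => rlKernel a (t - s) • Y τ s) := by
    have : Measurable fun p : ℝ × ℝ => rlKernel a (t - p.2) := by fun_prop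
    exact this.stronglyMeasurable.smul H.stronglyMeasurable
  refine ⟨hmeas.aestronglyMeasurable, ?_⟩
  have hle : ∀ τ, ∫⁻ s, ‖rlKernel a (t - s) • Y τ s‖ₑ
      ≤ (Set.Iio t).indicator (fun τ => C * K * ‖W τ‖ₑ) τ := by
    intro τ
    by_cases hτ : τ < t
    · rw [Set.indicator_of_mem (show τ ∈ Set.Iio t from hτ), mul_assoc]
      calc ∫⁻ s, ‖rlKernel a (t - s) • Y τ s‖ₑ
          ≤ ∫⁻ s, C * (‖rlKernel a₀ (t - s)‖ₑ * ‖Y τ s‖ₑ) := by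
            refine lintegral_mono fun s => ?_
            rw [enorm_smul]
            rcases le_or_gt s 0 with hs | hs
            · simp [H.eq_zero_of_time_nonpos τ hs]
            · rw [← mul_assoc]
              gcongr
              exact hCb a ⟨ha, le_rfl⟩ _ (by linarith)
        _ = C * ∫⁻ s, ‖rlKernel a₀ (t - s)‖ₑ * ‖Y τ s‖ₑ := lintegral_const_mul' _ _ hC
        _ ≤ C * (K * ‖W τ‖ₑ) := by gcongr; exact hKb τ
    · rw [Set.indicator_of_notMem (by simpa using hτ)]
      refine le_of_eq (lintegral_eq_zero_of_ae_eq_zero (Eventually.of_forall fun s => ?_))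
      rcases le_or_gt s τ with hs | hs
      · simp [H.eq_zero_of_le τ s hs]
      · simp [rlKernel_of_nonpos (show t - s ≤ 0 by linarith)]
  rw [hasFiniteIntegral_iff_enorm, Measure.volume_eq_prod,
    lintegral_prod _ hmeas.aestronglyMeasurable.enorm]
  refine (lintegral_mono hle).trans_lt ?_
  rw [lintegral_indicator measurableSet_Iio, lintegral_const_mul' _ _ (ENNReal.mul_ne_top hC hK)]
  exact ENNReal.mul_lt_top (ENNReal.mul_lt_top hC.lt_top hK.lt_top) (H.causal.integrableOn t).2

lemma causalLocInt_integral (H : DominatedFamily a₀ W Y) (h₀ : 0 < a₀) (h₁ : a₀ ≤ 1) :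
    CausalLocInt fun s => W s + ∫ τ, Y τ s := by
  refine H.causal.add ⟨fun s hs => ?_, fun T => ?_⟩
  · simp [H.eq_zero_of_time_nonpos _ hs]
  · have := (H.integrable h₀ h₁ T).integral_prod_right
    rw [← integrable_indicator_iff measurableSet_Iio, ← rlKernel_one_smul]
    refine this.congr (Eventually.of_forall fun s => ?_)
    exact MeasureTheory.integral_smul (rlKernel 1 (T - s)) fun τ => Y τ s

lemma integrable_rlConvDirac (H : DominatedFamily a₀ W Y) (h₀ : 0 < a₀) {a t : ℝ} (ha : a₀ ≤ a)
    (hW : Integrable fun s => rlKernel a (t - s) • W s) :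
    Integrable fun τ => rlConvDirac a τ (W τ) (Y τ) t :=
  hW.add (H.integrable h₀ ha t).integral_prod_left

lemma rlConv_integral (H : DominatedFamily a₀ W Y) (h₀ : 0 < a₀) {a t : ℝ} (ha : a₀ ≤ a)
    (hW : Integrable fun s => rlKernel a (t - s) • W s) :
    rlConv a (fun s => W s + ∫ τ, Y τ s) t = rlConv a W t + ∫ τ, rlConv a (Y τ) t := by
  have hi := H.integrable h₀ ha t
  have hsw : ∫ τ, rlConv a (Y τ) t = ∫ s, rlKernel a (t - s) • ∫ τ, Y τ s := by
    unfold rlConv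
    rw [integral_integral_swap hi]
    simp_rw [MeasureTheory.integral_smul]
  have hi' : Integrable fun s => rlKernel a (t - s) • ∫ τ, Y τ s :=
    hi.integral_prod_right.congr (Eventually.of_forall fun s =>
      MeasureTheory.integral_smul (rlKernel a (t - s)) fun τ => Y τ s)
  rw [hsw, rlConv, rlConv, ← MeasureTheory.integral_add hW hi']
  simp_rw [smul_add]

lemma rlConv_integral_eq_integral_rlConvDirac (H : DominatedFamily a₀ W Y) (h₀ : 0 < a₀)
    {a t : ℝ} (ha : a₀ ≤ a) (hW : Integrable fun s => rlKernel a (t - s) • W s) :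
    rlConv a (fun s => W s + ∫ τ, Y τ s) t = ∫ τ, rlConvDirac a τ (W τ) (Y τ) t := by
  rw [H.rlConv_integral h₀ ha hW]
  exact (MeasureTheory.integral_add hW (H.integrable h₀ ha t).integral_prod_left).symm

variable {lam : Measure ℝ} {B : ℝ → X →L[ℝ] X} {CB : ℝ≥0∞} {c d : ℝ}

lemma aestronglyMeasurable_rlConvDirac [SFinite lam] (H : DominatedFamily a₀ W Y) (c t : ℝ) :
    AEStronglyMeasurable (fun p : ℝ × ℝ => rlConvDirac (c - p.1) p.2 (W p.2) (Y p.2) t)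
      (lam.prod volume) := by
  have h1 : Measurable fun p : ℝ × ℝ => rlKernel (c - p.1) (t - p.2) := by fun_prop
  have h2 : Measurable fun p : (ℝ × ℝ) × ℝ => rlKernel (c - p.1.1) (t - p.2) := by fun_prop
  have h3 : StronglyMeasurable fun p : (ℝ × ℝ) × ℝ => Y p.1.2 p.2 :=
    H.stronglyMeasurable.comp_measurable
      (g := fun p : (ℝ × ℝ) × ℝ => (p.1.2, p.2)) (by fun_prop)
  exact (h1.aestronglyMeasurable.smul H.causal.aestronglyMeasurable.comp_snd).add
    (h2.stronglyMeasurable.smul h3).integral_prod_right'.aestronglyMeasurable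

variable [IsFiniteMeasure lam]

lemma integrable_apply_rlConvDirac (H : DominatedFamily a₀ W Y) (h₀ : 0 < a₀) (h₁ : a₀ ≤ 1)
    (hB : ∀ a x, ‖B a x‖ₑ ≤ CB * ‖x‖ₑ) (hCB : CB ≠ ∞)
    (hBc : Continuous fun p : ℝ × X => B p.1 p.2) (hlam : ∀ᵐ a ∂lam, a ∈ Set.Icc 0 d)
    (hcd : c - d = 1) (t : ℝ) :
    Integrable (Function.uncurry fun a τ => B a (rlConvDirac (c - a) τ (W τ) (Y τ) t))
      (lam.prod volume) := by
  have hmeas := H.aestronglyMeasurable_rlConvDirac (lam := lam) c t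
  obtain ⟨C, hC, hCb⟩ := exists_enorm_rlConvDirac_le (X := X) c d t (by linarith)
  have hi := H.integrable h₀ h₁ t
  refine ⟨hBc.comp_aestronglyMeasurable
    (measurable_fst.aestronglyMeasurable.prodMk hmeas), ?_⟩
  set F : ℝ → ℝ≥0∞ := fun τ => ‖rlKernel 1 (t - τ) • W τ‖ₑ
    + ∫⁻ s, ‖rlKernel 1 (t - s) • Y τ s‖ₑ with hF
  have hFm : AEMeasurable F :=
    (H.causal.integrable_rlKernel_smul le_rfl t).aestronglyMeasurable.enorm.add
      hi.aestronglyMeasurable.enorm.lintegral_prod_right'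
  have hFfin : ∫⁻ τ, F τ < ∞ := by
    have hWi := H.causal.integrable_rlKernel_smul le_rfl t
    rw [lintegral_add_left' hWi.aestronglyMeasurable.enorm]
    refine ENNReal.add_lt_top.2 ⟨hWi.2, ?_⟩
    have := hi.2
    rwa [hasFiniteIntegral_iff_enorm, Measure.volume_eq_prod,
      lintegral_prod _ hi.aestronglyMeasurable.enorm] at this
  have hle : ∀ᵐ p ∂lam.prod volume,
      ‖B p.1 (rlConvDirac (c - p.1) p.2 (W p.2) (Y p.2) t)‖ₑ ≤ CB * C * F p.2 := by
    filter_upwards [Measure.quasiMeasurePreserving_fst.ae hlam] with p hp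
    refine (hB _ _).trans ?_
    rw [mul_assoc]
    gcongr
    rcases le_or_gt p.2 0 with hτ | hτ
    · have hY : Y p.2 = 0 := funext (H.eq_zero_of_nonpos _ hτ)
      simp [rlConvDirac, rlConv, hY, H.causal.eq_zero _ hτ]
    · refine (hCb p.1 hp p.2 hτ.le _ _ (fun s hs => H.eq_zero_of_time_nonpos _ hs) t
        le_rfl).trans_eq ?_
      simp_rw [hF, hcd, enorm_smul]
  rw [hasFiniteIntegral_iff_enorm]
  refine (lintegral_mono_ae hle).trans_lt ?_
  rw [lintegral_prod_mul (f := fun _ => CB * C) aemeasurable_const hFm, lintegral_const]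
  exact ENNReal.mul_lt_top (ENNReal.mul_lt_top (ENNReal.mul_lt_top hCB.lt_top hC.lt_top)
    (measure_lt_top _ _)) hFfin

lemma integral_apply_rlConv [CompleteSpace X] (H : DominatedFamily a₀ W Y) (h₀ : 0 < a₀)
    (h₁ : a₀ ≤ 1)
    (hB : ∀ a x, ‖B a x‖ₑ ≤ CB * ‖x‖ₑ) (hCB : CB ≠ ∞)
    (hBc : Continuous fun p : ℝ × X => B p.1 p.2) (hlam : ∀ᵐ a ∂lam, a ∈ Set.Icc 0 d)
    (hcd : c - d = 1) (t : ℝ) :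
    ∫ a, B a (rlConv (c - a) (fun s => W s + ∫ τ, Y τ s) t) ∂lam
      = ∫ τ, distConv lam B c τ (W τ) (Y τ) t := by
  unfold distConv
  rw [← integral_integral_swap (H.integrable_apply_rlConvDirac h₀ h₁ hB hCB hBc hlam hcd t)]
  refine integral_congr_ae (hlam.mono fun a ha => ?_)
  have h1a : 1 ≤ c - a := by linarith [ha.2]
  have hW := H.causal.integrable_rlKernel_smul h1a t
  dsimp only
  rw [H.rlConv_integral_eq_integral_rlConvDirac h₀ (h₁.trans h1a) hW,
    ContinuousLinearMap.integral_comp_comm _ (H.integrable_rlConvDirac h₀ (h₁.trans h1a) hW)]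

end DominatedFamily

end

section

variable {X : Type*} [NormedAddCommGroup X]

lemma stronglyMeasurable_indicator_of_continuousOn {α : Type*} [TopologicalSpace α]
    [SecondCountableTopology α] [MeasurableSpace α] [OpensMeasurableSpace α] {f : α → X}
    {s : Set α} (hs : MeasurableSet s) (hf : ContinuousOn f s) :
    StronglyMeasurable (s.indicator f) := by
  classical
  have := (MeasurableEmbedding.subtype_coe hs).stronglyMeasurable_extend
    hf.domRestrict.stronglyMeasurable (stronglyMeasurable_const (b := (0 : X)))
  convert this using 1
  ext x
  by_cases hx : x ∈ s
  · rw [Set.indicator_of_mem hx]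
    exact (Subtype.val_injective.extend_apply (s.domRestrict f) (fun _ => 0) ⟨x, hx⟩).symm
  · rw [Set.indicator_of_notMem hx, Function.extend_apply']
    rintro ⟨y, rfl⟩
    exact hx y.2

variable [NormedSpace ℝ X] [CompleteSpace X] {m : ℕ} {μ : ℝ} {lam : Measure ℝ}
  {B : ℝ → X →L[ℝ] X}

/-- The homogeneous equation, written through convolutions of the top derivative. -/
lemma rlConv_add_distConv_eq_zero (hm : 0 < m) (hμ1 : (m : ℝ) - 1 < μ) (hμ2 : μ < m)
    (hlam : ∀ᵐ a ∂lam, a ∈ Set.Icc 0 ((m : ℝ) - 1)) {B' : ℝ → X →L[ℝ] X}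
    (hBB : ∀ a ∈ Set.Icc 0 ((m : ℝ) - 1), B' a = B a)
    {v : ℝ → X} {x : X} {τ t : ℝ} (hτ : 0 ≤ τ) (ht : τ < t) (hv : ContDiff ℝ m v)
    (h0 : ∀ k, k + 1 < m → Tendsto (fun t => iteratedDeriv k v t) (𝓝[>] τ) (𝓝 0))
    (h1 : Tendsto (fun t => iteratedDeriv (m - 1) v t) (𝓝[>] τ) (𝓝 x))
    (heq : caputoD μ τ v t + ∫ a, B a (caputoD a τ v t) ∂lam = 0) :
    rlConv ((m : ℝ) - μ) ((Set.Ioi τ).indicator (iteratedDeriv m v)) t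
      + distConv lam B' m τ x ((Set.Ioi τ).indicator (iteratedDeriv m v)) t = 0 := by
  have hceil := natCeil_eq_of_lt hm hμ1 hμ2
  rw [caputoD_eq_rlConv (by rw [hceil]; exact hμ2.ne) v ht.le, hceil] at heq
  rw [← heq, distConv]
  congr 1
  refine integral_congr_ae (hlam.mono fun a ha => ?_)
  dsimp only
  rw [hBB a ha, caputoD_eq_rlConvDirac hm
    (causalLocInt_indicator (hv.continuous_iteratedDeriv m le_rfl) hτ)
    (fun s hs => Set.indicator_of_notMem (by simpa using hs) _)
    (iteratedDeriv_eq_rlConvDirac hτ hv h0 h1) ha ht]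

end

end

/-- Theorem 3.2, fractional Duhamel principle, Caputo derivative,
distributed order: with `_τL^{(μ,λ)}[u](t) = _τD_*^μ u(t) + ∫ B(α) (_τD_*^α u(t)) dλ(α)`,
if `V(t,τ)` solves the homogeneous Cauchy problem with
`∂_t^{m-1} V|_{t=τ+} = D_+^{m-μ} h(τ)`, then `u(t) = ∫_0^t V(t,τ) dτ` solves
`L^{(μ,λ)}[u] = h` on `(0,∞)` with `u^{(k)}(0) = 0`, `k = 0,…,m-1`. -/
theorem fractional_duhamel_caputo_distributed
    {X : Type*} [NormedAddCommGroup X] [NormedSpace ℝ X] [CompleteSpace X]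
    (m : ℕ) (hm : 0 < m) (μ : ℝ) (hμ1 : (m : ℝ) - 1 < μ) (hμ2 : μ < m)
    (lam : Measure ℝ) [IsFiniteMeasure lam]
    (hlam : lam (Set.Icc (0 : ℝ) ((m : ℝ) - 1))ᶜ = 0)
    (B : ℝ → X →L[ℝ] X)
    (hBstrong : ∀ x : X, ContinuousOn (fun a => B a x) (Set.Icc (0 : ℝ) ((m : ℝ) - 1)))
    (hBbdd : ∃ C : ℝ, ∀ a ∈ Set.Icc (0 : ℝ) ((m : ℝ) - 1), ‖B a‖ ≤ C)
    (h : ℝ → X) (hh : ContDiff ℝ 1 h)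
    (hDcont : ContinuousOn (rlDeriv ((m : ℝ) - μ) 0 h) (Set.Ioi 0))
    (hDint : LocallyIntegrableOn (rlDeriv ((m : ℝ) - μ) 0 h) (Set.Ici 0))
    (V : ℝ → ℝ → X)
    (hVsmooth : ∀ τ, 0 ≤ τ → ContDiff ℝ m (fun t => V t τ))
    (hVjoint : ∀ j ≤ m, ContinuousOn
      (fun p : ℝ × ℝ => iteratedDeriv j (fun t => V t p.2) p.1)
      {p : ℝ × ℝ | 0 ≤ p.2 ∧ p.2 < p.1})
    (heq : ∀ τ, 0 ≤ τ → ∀ t, τ < t →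
      caputoD μ τ (fun s => V s τ) t
        + ∫ a, B a (caputoD a τ (fun s => V s τ) t) ∂lam = 0)
    (hic0 : ∀ τ, 0 ≤ τ → ∀ k, k + 1 < m →
      Filter.Tendsto (fun t => iteratedDeriv k (fun s => V s τ) t) (𝓝[>] τ) (𝓝 0))
    (hic1 : ∀ τ, 0 ≤ τ →
      Filter.Tendsto (fun t => iteratedDeriv (m - 1) (fun s => V s τ) t)
        (𝓝[>] τ) (𝓝 (rlDeriv ((m : ℝ) - μ) 0 h τ)))
    (u : ℝ → X) (hu : ∀ t, u t = ∫ τ in (0:ℝ)..t, V t τ) :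
    (∀ t, 0 < t →
      caputoD μ 0 u t + ∫ a, B a (caputoD a 0 u t) ∂lam = h t) ∧
    (∀ k < m, iteratedDerivWithin k u (Set.Ici 0) 0 = 0) := by
  have hd : (0 : ℝ) ≤ (m : ℝ) - 1 := by
    have : (1 : ℝ) ≤ m := by exact_mod_cast hm
    linarith
  have ha0 : 0 < (m : ℝ) - μ := by linarith
  have ha1 : (m : ℝ) - μ < 1 := by linarith
  have hlam' : ∀ᵐ a ∂lam, a ∈ Set.Icc 0 ((m : ℝ) - 1) := hlam
  obtain ⟨B', CB, hCB, hBB, hB', hBc⟩ := exists_continuous_extension_Icc hd hBstrong hBbdd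
  set W : ℝ → X := (Set.Ioi 0).indicator (rlDeriv ((m : ℝ) - μ) 0 h) with hW
  set Y : ℝ → ℝ → X := fun τ => (Set.Ioi 0).indicator
    (fun σ => (Set.Ioi σ).indicator (iteratedDeriv m fun s => V s σ)) τ with hY
  have hYpos : ∀ {τ : ℝ}, 0 < τ → Y τ = (Set.Ioi τ).indicator (iteratedDeriv m fun s => V s τ) :=
    fun {τ} hτ => Set.indicator_of_mem (show τ ∈ Set.Ioi 0 from hτ) _
  have hYnonpos : ∀ {τ : ℝ}, τ ≤ 0 → Y τ = 0 :=
    fun {τ} hτ => Set.indicator_of_notMem (by simpa using hτ) _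
  have hWpos : ∀ {τ : ℝ}, 0 < τ → W τ = rlDeriv ((m : ℝ) - μ) 0 h τ :=
    fun {τ} hτ => Set.indicator_of_mem (show τ ∈ Set.Ioi 0 from hτ) _
  have hYle : ∀ τ s, s ≤ τ → Y τ s = 0 := by
    intro τ s hs
    rcases le_or_gt τ 0 with hτ | hτ
    · rw [hYnonpos hτ]; rfl
    · rw [hYpos hτ, Set.indicator_of_notMem (by simpa using hs)]
  have hYmeas : StronglyMeasurable (Function.uncurry Y) := by
    have hset : MeasurableSet {p : ℝ × ℝ | 0 < p.1 ∧ p.1 < p.2} :=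
      (measurableSet_lt measurable_const measurable_fst).inter
        (measurableSet_lt measurable_fst measurable_snd)
    have := stronglyMeasurable_indicator_of_continuousOn hset
      (((hVjoint m le_rfl).comp continuous_swap.continuousOn
        (s := {p : ℝ × ℝ | 0 < p.1 ∧ p.1 < p.2}) (fun p hp => ⟨hp.1.le, hp.2⟩)))
    convert this using 1
    ext ⟨τ, s⟩
    by_cases hτ : 0 < τ
    · by_cases hs : τ < s <;> simp [Function.uncurry, hYpos hτ, hτ, hs, Set.indicator]
    · simp [Function.uncurry, hYnonpos (not_lt.1 hτ), hτ]
  have hkey : ∀ τ, 0 < τ → ∀ t, τ < t →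
      rlConv ((m : ℝ) - μ) (Y τ) t + distConv lam B' m τ (W τ) (Y τ) t = 0 := by
    intro τ hτ t ht
    rw [hYpos hτ, hWpos hτ]
    exact rlConv_add_distConv_eq_zero hm hμ1 hμ2 hlam' hBB hτ.le ht (hVsmooth τ hτ.le)
      (hic0 τ hτ.le) (hic1 τ hτ.le) (heq τ hτ.le t ht)
  have hcontD : ∀ τ, 0 ≤ τ → Continuous (iteratedDeriv m fun s => V s τ) := fun τ hτ =>
    (hVsmooth τ hτ).continuous_iteratedDeriv m le_rfl
  have H : DominatedFamily ((m : ℝ) - μ) W Y := by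
    refine ⟨causalLocInt_rlDeriv hh ha1, hYmeas, fun τ hτ s => by rw [hYnonpos hτ]; rfl, hYle,
      fun t => ?_⟩
    obtain ⟨K, hK, hKb⟩ := exists_lintegral_le_of_distConv_eq hB' hCB hBc hlam'
      hμ1 ha0 ha1 (by ring) t
    refine ⟨K, hK, fun τ => ?_⟩
    rcases le_or_gt τ 0 with hτ | hτ
    · simp [hYnonpos hτ]
    · refine hKb τ hτ.le (W τ) (Y τ) ?_ (hYmeas.comp_measurable measurable_prodMk_left)
        (hYle τ) (fun r => ?_) (fun r hr => ?_) t le_rfl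
      · rw [hYpos hτ]
        exact causalLocInt_indicator (hcontD τ hτ.le) hτ.le
      · rw [hYpos hτ]
        exact integrable_rlKernel_smul_indicator (hcontD τ hτ.le) ha0 τ r
      · rw [sub_add_cancel]
        exact hkey τ hτ r hr
  set G : ℝ → X := fun s => W s + ∫ τ, Y τ s
  have hG : CausalLocInt G := H.causalLocInt_integral ha0 ha1.le
  have huG : ∀ t, 0 ≤ t → u t = rlConv (m : ℝ) G t := by
    intro t ht
    have h1m : (1 : ℝ) ≤ m := by linarith
    rw [H.rlConv_integral_eq_integral_rlConvDirac ha0 (ha1.le.trans h1m)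
      (H.causal.integrable_rlKernel_smul h1m t), hu, integral_of_le ht,
      ← MeasureTheory.integral_indicator measurableSet_Ioc]
    refine integral_congr_ae ?_
    filter_upwards [Measure.ae_ne volume t] with τ hτt
    rcases le_or_gt τ 0 with hτ | hτ
    · rw [Set.indicator_of_notMem (by simp [hτ])]
      simp [rlConvDirac, rlConv, hYnonpos hτ, H.causal.eq_zero τ hτ]
    · rcases lt_or_gt_of_ne hτt with hlt | hgt
      · rw [Set.indicator_of_mem (show τ ∈ Set.Ioc 0 t from ⟨hτ, hlt.le⟩), hYpos hτ, hWpos hτ]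
        have := iteratedDeriv_eq_rlConvDirac hτ.le (hVsmooth τ hτ.le) (hic0 τ hτ.le)
          (hic1 τ hτ.le) 0 hm t hlt
        simpa using this
      · rw [Set.indicator_of_notMem (by simp [hgt]), rlConvDirac_eq_zero (hYle τ) hgt.le]
  refine ⟨fun t ht => ?_, fun k hk => iteratedDerivWithin_eq_zero_of_eq_rlConv hG huG hk⟩
  have hdist : ∫ a, B a (caputoD a 0 u t) ∂lam = ∫ τ, distConv lam B' m τ (W τ) (Y τ) t := by
    rw [← H.integral_apply_rlConv ha0 ha1.le hB' hCB hBc hlam' (sub_sub_cancel _ _)]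
    refine integral_congr_ae (hlam'.mono fun a ha => ?_)
    dsimp only
    rw [hBB a ha, caputoD_eq_rlConvDirac hm hG hG.eq_zero (x := 0)
      (fun k hk r hr => by rw [rlConvDirac_zero, iteratedDeriv_eq_of_eq_rlConv hG huG hk hr])
      ha ht, rlConvDirac_zero]
  have hneg : ∀ τ, distConv lam B' m τ (W τ) (Y τ) t = -rlConv ((m : ℝ) - μ) (Y τ) t := by
    intro τ
    rcases le_or_gt τ 0 with hτ | hτ
    · simp [distConv, rlConvDirac, rlConv, hYnonpos hτ, H.causal.eq_zero τ hτ]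
    · rcases lt_or_ge τ t with hlt | hge
      · exact eq_neg_of_add_eq_zero_right (hkey τ hτ t hlt)
      · rw [distConv_eq_zero (hYle τ) hge, rlConv_eq_zero (hYle τ) hge, neg_zero]
  rw [caputoD_eq_of_eq_rlConv hG hm hμ1 hμ2 huG ht, hdist,
    H.rlConv_integral ha0 le_rfl (integrable_rlKernel_smul_rlDeriv hh ha0 ha1 t),
    rlConv_rlDeriv hh ha0 ha1 ht]
  simp_rw [hneg]
  rw [MeasureTheory.integral_neg, add_neg_cancel_right]
end

section
/- Let X be a Banach space, k a positive integer, and k−1 < α ≤ k. Suppose V(t,τ), defined for 0 ≤ τ ≤ t, is k times continuously differentiable in t with all partial derivatives ∂^j V/∂t^j, 0 ≤ j ≤ k, jointly continuous, and (∂^j V/∂t^j)(t,τ)|_{t=τ+} = 0 for j = 0, …, k−1. Then for u(t) = ∫_0^t V(t,τ) dτ one has, for all t > 0, D_*^α u(t) = ∫_0^t _τD_*^α V(t,τ) dτ; that is, the Caputo–Djrbashian derivative of order α of the Duhamel integral equals the Duhamel integral of the Caputo–Djrbashian derivatives with moving terminal point τ. -/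
open MeasureTheory Filter Topology intervalIntegral

section Triangle

variable {X : Type*} [NormedAddCommGroup X] [NormedSpace ℝ X]

/-- A weighted continuous function is integrable over the triangle `{τ ≤ s}` in `(0, t]²`. -/
lemma integrable_triangle_smul {F : ℝ × ℝ → X} (hF : Continuous F) {w : ℝ → ℝ} {t : ℝ}
    (hw : IntegrableOn w (Set.Ioc 0 t)) :
    Integrable ({p : ℝ × ℝ | p.2 ≤ p.1}.indicator fun p => w p.1 • F p)
      ((volume.restrict (Set.Ioc 0 t)).prod (volume.restrict (Set.Ioc 0 t))) := by
  refine Integrable.indicator ?_ (measurableSet_le measurable_snd measurable_fst)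
  obtain ⟨C, hC⟩ := ((isCompact_Icc (a := (0 : ℝ)) (b := t)).prod
    (isCompact_Icc (a := (0 : ℝ)) (b := t))).exists_bound_of_continuousOn hF.continuousOn
  have hw' : Integrable (fun p : ℝ × ℝ => w p.1)
      ((volume.restrict (Set.Ioc 0 t)).prod (volume.restrict (Set.Ioc 0 t))) :=
    Integrable.comp_fst hw _
  refine (hw'.norm.mul_const C).mono' (hw'.aestronglyMeasurable.smul hF.aestronglyMeasurable) ?_
  rw [Measure.prod_restrict]
  refine (ae_restrict_iff' (measurableSet_Ioc.prod measurableSet_Ioc)).2 (ae_of_all _ ?_)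
  intro p hp
  rw [norm_smul]
  exact mul_le_mul_of_nonneg_left
    (hC p ⟨Set.Ioc_subset_Icc_self hp.1, Set.Ioc_subset_Icc_self hp.2⟩) (norm_nonneg _)

/-- Dirichlet's formula: interchange of the order of integration over a triangle. -/
lemma integral_smul_integral_triangle_swap {F : ℝ × ℝ → X} (hF : Continuous F) {w : ℝ → ℝ} {t : ℝ}
    (ht : 0 ≤ t) (hw : IntervalIntegrable w volume 0 t) :
    ∫ s in (0 : ℝ)..t, w s • ∫ τ in (0 : ℝ)..s, F (s, τ) =
      ∫ τ in (0 : ℝ)..t, ∫ s in τ..t, w s • F (s, τ) := by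
  have hw' : IntegrableOn w (Set.Ioc 0 t) := (intervalIntegrable_iff_integrableOn_Ioc_of_le ht).1 hw
  have hswap := integral_integral_swap
    (f := fun s τ => {p : ℝ × ℝ | p.2 ≤ p.1}.indicator (fun p => w p.1 • F p) (s, τ))
    (integrable_triangle_smul hF hw')
  rw [integral_of_le ht, integral_of_le ht]
  convert hswap using 1
  · refine setIntegral_congr_fun measurableSet_Ioc fun s hs => ?_
    have h : (fun τ => {p : ℝ × ℝ | p.2 ≤ p.1}.indicator (fun p => w p.1 • F p) (s, τ)) =
        (Set.Iic s).indicator fun τ => w s • F (s, τ) := by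
      ext τ
      simp [Set.indicator_apply]
    simp only [h]
    rw [setIntegral_indicator measurableSet_Iic, Set.Ioc_inter_Iic, min_eq_right hs.2,
      ← intervalIntegral.integral_smul, integral_of_le hs.1.le]
  · refine setIntegral_congr_fun measurableSet_Ioc fun τ hτ => ?_
    have h : (fun s => {p : ℝ × ℝ | p.2 ≤ p.1}.indicator (fun p => w p.1 • F p) (s, τ)) =
        (Set.Ici τ).indicator fun s => w s • F (s, τ) := by
      ext s
      simp [Set.indicator_apply]
    have hset : Set.Ioc 0 t ∩ Set.Ici τ = Set.Icc τ t := by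
      ext s
      simp only [Set.mem_inter_iff, Set.mem_Ioc, Set.mem_Ici, Set.mem_Icc]
      exact ⟨fun h => ⟨h.2, h.1.2⟩, fun h => ⟨⟨hτ.1.trans_le h.1, h.2⟩, h.1⟩⟩
    simp only [h]
    rw [setIntegral_indicator measurableSet_Ici, hset, integral_Icc_eq_integral_Ioc,
      integral_of_le hτ.2]

/-- A function continuous on `{0 ≤ τ ≤ s}` extends to a continuous function on the plane. -/
lemma exists_continuous_eq_of_continuousOn_triangle {Y : Type*} [TopologicalSpace Y]
    {G : ℝ × ℝ → Y}
    (hG : ContinuousOn G {p : ℝ × ℝ | 0 ≤ p.2 ∧ p.2 ≤ p.1}) :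
    ∃ F : ℝ × ℝ → Y, Continuous F ∧ ∀ s τ, 0 ≤ τ → τ ≤ s → F (s, τ) = G (s, τ) := by
  refine ⟨fun p => G (max p.1 (max p.2 0), max p.2 0), ?_, fun s τ h0 h1 => ?_⟩
  · exact hG.comp_continuous (by fun_prop) fun p => ⟨le_max_right _ _, le_max_right _ _⟩
  · simp [h0, h1]

/-- Dirichlet's formula for an integrand continuous only on the triangle. -/
lemma integral_smul_integral_triangle_swap_of_continuousOn {G : ℝ → ℝ → X}
    (hG : ContinuousOn (fun p : ℝ × ℝ => G p.1 p.2) {p : ℝ × ℝ | 0 ≤ p.2 ∧ p.2 ≤ p.1})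
    {w : ℝ → ℝ} {t : ℝ} (ht : 0 ≤ t) (hw : IntervalIntegrable w volume 0 t) :
    ∫ s in (0 : ℝ)..t, w s • ∫ τ in (0 : ℝ)..s, G s τ =
      ∫ τ in (0 : ℝ)..t, ∫ s in τ..t, w s • G s τ := by
  obtain ⟨F, hF, hFG⟩ := exists_continuous_eq_of_continuousOn_triangle hG
  convert integral_smul_integral_triangle_swap hF ht hw using 1
  · refine integral_congr fun s hs => ?_
    rw [Set.uIcc_of_le ht] at hs
    congr 1
    refine integral_congr fun τ hτ => ?_
    rw [Set.uIcc_of_le hs.1] at hτ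
    exact (hFG s τ hτ.1 hτ.2).symm
  · refine integral_congr fun τ hτ => ?_
    rw [Set.uIcc_of_le ht] at hτ
    refine integral_congr fun s hs => ?_
    rw [Set.uIcc_of_le hτ.2] at hs
    simp only [hFG s τ hτ.1 hs.1]

/-- Differentiation of a Duhamel integral whose integrand vanishes on the diagonal. -/
lemma hasDerivAt_integral_duhamel [CompleteSpace X] {W W' : ℝ → ℝ → X}
    (hW : ∀ τ, 0 ≤ τ → ∀ s, HasDerivAt (fun r => W r τ) (W' s τ) s)
    (hW' : ∀ τ, 0 ≤ τ → Continuous fun s => W' s τ)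
    (hjoint : ContinuousOn (fun p : ℝ × ℝ => W' p.1 p.2) {p : ℝ × ℝ | 0 ≤ p.2 ∧ p.2 ≤ p.1})
    (hdiag : ∀ τ, 0 ≤ τ → W τ τ = 0) {t : ℝ} (ht : 0 < t) :
    HasDerivAt (fun r => ∫ τ in (0 : ℝ)..r, W r τ) (∫ τ in (0 : ℝ)..t, W' t τ) t := by
  obtain ⟨F, hF, hFG⟩ := exists_continuous_eq_of_continuousOn_triangle hjoint
  have hcont : Continuous fun s => ∫ τ in (0 : ℝ)..s, F (s, τ) :=
    continuous_parametric_intervalIntegral_of_continuous (f := fun s τ => F (s, τ)) hF continuous_id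
  have hinner : ∀ s, 0 ≤ s → ∫ τ in (0 : ℝ)..s, F (s, τ) = ∫ τ in (0 : ℝ)..s, W' s τ := by
    intro s hs
    refine integral_congr fun τ hτ => ?_
    rw [Set.uIcc_of_le hs] at hτ
    exact hFG s τ hτ.1 hτ.2
  have hderiv : HasDerivAt (fun r => ∫ s in (0 : ℝ)..r, ∫ τ in (0 : ℝ)..s, F (s, τ))
      (∫ τ in (0 : ℝ)..t, F (t, τ)) t :=
    integral_hasDerivAt_right (hcont.intervalIntegrable _ _)
      (hcont.stronglyMeasurableAtFilter _ _) hcont.continuousAt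
  rw [hinner t ht.le] at hderiv
  refine hderiv.congr_of_eventuallyEq ?_
  filter_upwards [lt_mem_nhds ht] with r hr
  have hswap := integral_smul_integral_triangle_swap_of_continuousOn hjoint hr.le
    (w := fun _ => 1) intervalIntegrable_const
  simp only [one_smul] at hswap
  have hl : ∫ s in (0 : ℝ)..r, ∫ τ in (0 : ℝ)..s, F (s, τ) =
      ∫ s in (0 : ℝ)..r, ∫ τ in (0 : ℝ)..s, W' s τ := by
    refine integral_congr fun s hs => ?_
    rw [Set.uIcc_of_le hr.le] at hs
    exact hinner s hs.1
  rw [hl, hswap]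
  refine integral_congr fun τ hτ => ?_
  rw [Set.uIcc_of_le hr.le] at hτ
  rw [integral_eq_sub_of_hasDerivAt (fun s _ => hW τ hτ.1 s)
    ((hW' τ hτ.1).intervalIntegrable _ _), hdiag τ hτ.1, sub_zero]

/-- Iterated derivatives of a Duhamel integral pass under the integral sign when the
derivatives of lower order of the integrand vanish on the diagonal. -/
lemma iteratedDeriv_integral_duhamel [CompleteSpace X] {k : ℕ} {V : ℝ → ℝ → X}
    (hVsmooth : ∀ τ, 0 ≤ τ → ContDiff ℝ k (fun t => V t τ))
    (hVjoint : ∀ j ≤ k, ContinuousOn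
      (fun p : ℝ × ℝ => iteratedDeriv j (fun t => V t p.2) p.1)
      {p : ℝ × ℝ | 0 ≤ p.2 ∧ p.2 ≤ p.1})
    (hic : ∀ τ, 0 ≤ τ → ∀ j < k,
      Tendsto (fun t => iteratedDeriv j (fun s => V s τ) t) (𝓝[>] τ) (𝓝 0))
    {j : ℕ} (hj : j ≤ k) {t : ℝ} (ht : 0 < t) :
    iteratedDeriv j (fun r => ∫ τ in (0 : ℝ)..r, V r τ) t =
      ∫ τ in (0 : ℝ)..t, iteratedDeriv j (fun s => V s τ) t := by
  induction j generalizing t with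
  | zero => simp only [iteratedDeriv_zero]
  | succ j ih =>
    have hjk : j < k := hj
    rw [iteratedDeriv_succ]
    have hloc : iteratedDeriv j (fun r => ∫ τ in (0 : ℝ)..r, V r τ) =ᶠ[𝓝 t]
        fun r => ∫ τ in (0 : ℝ)..r, iteratedDeriv j (fun s => V s τ) r := by
      filter_upwards [lt_mem_nhds ht] with r hr
      exact ih hjk.le hr
    rw [hloc.deriv_eq]
    refine (hasDerivAt_integral_duhamel (W := fun r τ => iteratedDeriv j (fun s => V s τ) r)
      (W' := fun r τ => iteratedDeriv (j + 1) (fun s => V s τ) r)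
      (fun τ hτ s => ?_) (fun τ hτ => ?_) (hVjoint _ hj) (fun τ hτ => ?_) ht).deriv
    · rw [iteratedDeriv_succ]
      exact ((hVsmooth τ hτ).differentiable_iteratedDeriv j
        (by exact_mod_cast hjk) s).hasDerivAt
    · exact (hVsmooth τ hτ).continuous_iteratedDeriv (j + 1) (by exact_mod_cast hj)
    · have hc := (hVsmooth τ hτ).continuous_iteratedDeriv j (by exact_mod_cast hjk.le)
      exact tendsto_nhds_unique ((hc.tendsto τ).mono_left nhdsWithin_le_nhds) (hic τ hτ j hjk)

end Triangle

/-- for `k-1 < α ≤ k` and `V(t,τ)` with vanishing one-sided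
`t`-derivatives of orders `0,…,k-1` at `t = τ+`, the Caputo–Djrbashian derivative of
order `α` of the Duhamel integral `u(t) = ∫_0^t V(t,τ) dτ` equals the Duhamel
integral of the Caputo–Djrbashian derivatives with moving terminal point:
`D_*^α u(t) = ∫_0^t _τD_*^α V(t,τ) dτ` for `t > 0`. -/
theorem caputo_derivative_of_duhamel_integral
    {X : Type*} [NormedAddCommGroup X] [NormedSpace ℝ X] [CompleteSpace X]
    (k : ℕ) (hk : 0 < k) (α : ℝ) (hα1 : (k : ℝ) - 1 < α) (hα2 : α ≤ k)
    (V : ℝ → ℝ → X)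
    (hVsmooth : ∀ τ, 0 ≤ τ → ContDiff ℝ k (fun t => V t τ))
    (hVjoint : ∀ j ≤ k, ContinuousOn
      (fun p : ℝ × ℝ => iteratedDeriv j (fun t => V t p.2) p.1)
      {p : ℝ × ℝ | 0 ≤ p.2 ∧ p.2 ≤ p.1})
    (hic : ∀ τ, 0 ≤ τ → ∀ j < k,
      Filter.Tendsto (fun t => iteratedDeriv j (fun s => V s τ) t) (𝓝[>] τ) (𝓝 0))
    (u : ℝ → X) (hu : ∀ t, u t = ∫ τ in (0:ℝ)..t, V t τ) :
    ∀ t, 0 < t →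
      caputoD α 0 u t = ∫ τ in (0:ℝ)..t, caputoD α τ (fun s => V s τ) t := by
  have hceil : ⌈α⌉₊ = k := by
    rw [Nat.ceil_eq_iff hk.ne', Nat.cast_pred hk]
    exact ⟨hα1, hα2⟩
  intro t ht
  obtain rfl : u = fun r => ∫ τ in (0 : ℝ)..r, V r τ := funext hu
  have hD : ∀ s, 0 < s → iteratedDeriv k (fun r => ∫ τ in (0 : ℝ)..r, V r τ) s =
      ∫ τ in (0 : ℝ)..s, iteratedDeriv k (fun r => V r τ) s :=
    fun s hs => iteratedDeriv_integral_duhamel hVsmooth hVjoint hic le_rfl hs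
  simp only [caputoD, hceil]
  split_ifs with h
  · exact hD t ht
  · have hαk : α < k := lt_of_le_of_ne hα2 h
    have hw : IntervalIntegrable (fun s : ℝ => (t - s) ^ ((k : ℝ) - α - 1)) volume 0 t := by
      have := (intervalIntegrable_rpow' (a := t) (b := 0) (r := (k : ℝ) - α - 1)
        (by linarith)).comp_sub_left t
      simpa using this
    rw [intervalIntegral.integral_smul,
      ← integral_smul_integral_triangle_swap_of_continuousOn (hVjoint k le_rfl) ht.le hw]
    congr 1
    refine integral_congr_ae (ae_of_all _ fun s hs => ?_)
    rw [Set.uIoc_of_le ht.le] at hs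
    rw [hD s hs.1]
end
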